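/- arXiv:0912.1046 — 2 statements merged into one kernel-verified Lean document; each statement's English description precedes it below -/
import Mathlib

section
/- Let n ≥ 2, k > 2, and let V ∈ ℂ[q₁,…,qₙ] be a homogeneous polynomial of degree k such that all Darboux points of V are proper and simple, i.e.: (i) V′(d) = 0 with d ∈ ℂⁿ implies d = 0; (ii) for every d in the finite set S := {d ∈ ℂⁿ ∖ {0} : V′(d) = d}, det(V″(d) − 1) ≠ 0. For d ∈ S, let Λ(d) be the multiset of roots of the characteristic polynomial of V″(d) − 1 with one copy of the trivial root k−2 removed. Then for every r = 0, 1, …, n−1: Σ_{d ∈ S} τ_r(Λ(d)) / τ_{n−1}(Λ(d)) = (k−2)·(−1)^{r+n−1}·Σ_{i=0}^{r} C(n−i−1, r−i)·(k−1)^{i}, where C(a,b) denotes the binomial coefficient. (Equivalently, dividing by k−2, the same identity without the factor (k−2) holds for the sum over the set 𝒟(V) of projective Darboux points.) -/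
open MvPolynomial

/-- The gradient of a multivariate polynomial, evaluated at a point. -/
noncomputable def grad {n : ℕ} (V : MvPolynomial (Fin n) ℂ) (d : Fin n → ℂ) : Fin n → ℂ :=
  fun i => eval d (pderiv i V)

/-- The Hessian matrix of a multivariate polynomial, evaluated at a point. -/
noncomputable def hess {n : ℕ} (V : MvPolynomial (Fin n) ℂ) (d : Fin n → ℂ) :
    Matrix (Fin n) (Fin n) ℂ :=
  Matrix.of fun i j => eval d (pderiv i (pderiv j V))

/-- The multiset `Λ(d)` of shifted nontrivial eigenvalues at a normalized proper Darboux
point: the roots of the characteristic polynomial of `V''(d) − 1` (counted with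
multiplicity) with one copy of the trivial root `k−2` removed. -/
noncomputable def shiftedSpectrum {n : ℕ} (k : ℕ) (V : MvPolynomial (Fin n) ℂ)
    (d : Fin n → ℂ) : Multiset ℂ :=
  ((hess V d - 1).charpoly.roots).erase ((k : ℂ) - 2)

section EulerJacobi

variable {n : ℕ}

/-- First order Taylor expansion of a polynomial at a point. -/
lemma MvPolynomial.exists_sub_eval_eq_sum (z : Fin n → ℂ) (g : MvPolynomial (Fin n) ℂ) :
    ∃ b : Fin n → MvPolynomial (Fin n) ℂ,
      g - C (eval z g) = ∑ j, b j * (X j - C (z j)) := by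
  induction g using MvPolynomial.induction_on with
  | C a => exact ⟨0, by simp⟩
  | add p q hp hq =>
    obtain ⟨b, hb⟩ := hp
    obtain ⟨c, hc⟩ := hq
    refine ⟨b + c, ?_⟩
    simp only [Pi.add_apply, add_mul, Finset.sum_add_distrib, ← hb, ← hc, map_add]
    ring
  | mul_X p i hp =>
    obtain ⟨b, hb⟩ := hp
    refine ⟨fun j => b j * X i + if j = i then C (eval z p) else 0, ?_⟩
    have h : ∑ j, (if j = i then C (eval z p) else 0) * (X j - C (z j)) =
        C (eval z p) * (X i - C (z i)) := by
      simp [ite_mul]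
    have h' : ∑ j, b j * X i * (X j - C (z j)) = (p - C (eval z p)) * X i := by
      rw [hb, Finset.sum_mul]
      exact Finset.sum_congr rfl fun j _ => by ring
    simp only [add_mul, Finset.sum_add_distrib, h, h', map_mul, eval_X]
    ring

lemma MvPolynomial.eval_pderiv_sum_mul {ι : Type*} [Fintype ι] (z : Fin n → ℂ)
    (k : Fin n) (b F : ι → MvPolynomial (Fin n) ℂ) (hF : ∀ j, eval z (F j) = 0) :
    eval z (pderiv k (∑ j, b j * F j)) = ∑ j, eval z (b j) * eval z (pderiv k (F j)) := by
  simp only [map_sum, Derivation.leibniz, smul_eq_mul, map_add, map_mul, hF, zero_mul, add_zero]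

/-- A zero-dimensional ideal all of whose zeros are nondegenerate contains every polynomial
vanishing at its zeros. -/
lemma MvPolynomial.mem_span_of_nondegenerate_zeros {F : Fin n → MvPolynomial (Fin n) ℂ}
    (hJ : ∀ z, (∀ j, eval z (F j) = 0) →
      (Matrix.of fun j k => eval z (pderiv k (F j))).det ≠ 0)
    {g : MvPolynomial (Fin n) ℂ} (hg : ∀ z, (∀ j, eval z (F j) = 0) → eval z g = 0) :
    g ∈ Ideal.span (Set.range F) := by
  set I := Ideal.span (Set.range F) with hI
  have hFI : ∀ j, F j ∈ I := fun j => Ideal.subset_span ⟨j, rfl⟩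
  let Q : Ideal (MvPolynomial (Fin n) ℂ) := I.colon {g}
  have hQ : ∀ h, h ∈ Q ↔ h * g ∈ I := fun h => by
    simp [Q, Submodule.mem_colon_singleton]
  have hempty : zeroLocus ℂ Q = ∅ := by
    rw [Set.eq_empty_iff_forall_notMem]
    intro z hz
    have hzF : ∀ j, eval z (F j) = 0 := fun j => by
      simpa [aeval_eq_eval] using hz (F j) ((hQ _).2 (I.mul_mem_right _ (hFI j)))
    choose B hB using fun j => exists_sub_eval_eq_sum z (F j)
    let M : Matrix (Fin n) (Fin n) (MvPolynomial (Fin n) ℂ) := Matrix.of B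
    have hMF : M.mulVec (fun j => X j - C (z j)) = F := by
      funext j
      simp only [Matrix.mulVec, dotProduct, M, Matrix.of_apply, ← hB, hzF, C_0, sub_zero]
    have hdet : ∀ j, M.det * (X j - C (z j)) ∈ I := fun j => by
      have h : M.adjugate.mulVec F = M.det • fun j => X j - C (z j) := by
        rw [← hMF, Matrix.mulVec_mulVec, Matrix.adjugate_mul, Matrix.smul_mulVec,
          Matrix.one_mulVec]
      have h' := congrFun h j
      rw [Pi.smul_apply, smul_eq_mul] at h'
      rw [← h', Matrix.mulVec, dotProduct]
      exact I.sum_mem fun i _ => I.mul_mem_left _ (hFI i)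
    have hmem : M.det ∈ Q := by
      rw [hQ]
      obtain ⟨c, hc⟩ := exists_sub_eval_eq_sum z g
      rw [hg z hzF, C_0, sub_zero] at hc
      rw [hc, Finset.mul_sum]
      refine I.sum_mem fun j _ => ?_
      rw [mul_left_comm]
      exact I.mul_mem_left _ (hdet j)
    apply hJ z hzF
    have h0 : eval z M.det = 0 := by simpa [aeval_eq_eval] using hz _ hmem
    rw [RingHom.map_det] at h0
    rw [← h0]
    congr 1
    ext j k
    have hj : F j = ∑ l, B j l * (X l - C (z l)) := by rw [← hB, hzF, C_0, sub_zero]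
    rw [Matrix.of_apply, hj, eval_pderiv_sum_mul _ _ _ _ (by simp)]
    simp [M, pderiv_X, Pi.single_apply, apply_ite (eval z)]
  have htop : Q = ⊤ := by
    rw [← Ideal.radical_eq_top, ← vanishingIdeal_zeroLocus_eq_radical (K := ℂ), hempty,
      vanishingIdeal_empty]
  simpa using (hQ 1).1 (htop ▸ Submodule.mem_top)

/-- Forms of large degree lie in an ideal generated by forms whose only common zero is the
origin, with homogeneous coefficients. -/
lemma MvPolynomial.exists_homogeneous_repr {m : ℕ} {f : Fin n → MvPolynomial (Fin n) ℂ}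
    (hf : ∀ j, (f j).IsHomogeneous m) (h0 : ∀ z, (∀ j, eval z (f j) = 0) → z = 0) :
    ∃ N, ∀ D, N ≤ D → m ≤ D → ∀ u : MvPolynomial (Fin n) ℂ, u.IsHomogeneous D →
      ∃ b : Fin n → MvPolynomial (Fin n) ℂ,
        (∀ j, (b j).totalDegree + m ≤ D) ∧ u = ∑ j, b j * f j := by
  obtain ⟨N, hN⟩ := Ideal.exists_pow_le_of_le_radical_of_fg
    (I := idealOfVars (Fin n) ℂ) (J := Ideal.span (Set.range f)) (by
      rw [← vanishingIdeal_zeroLocus_eq_radical (K := ℂ), Ideal.span_le]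
      rintro _ ⟨i, rfl⟩ z hz
      have : z = 0 := h0 z fun j => by
        simpa [aeval_eq_eval] using hz (f j) (Ideal.subset_span ⟨j, rfl⟩)
      simp [this]) (idealOfVars_fg _ _)
  refine ⟨N, fun D hND hmD u hu => ?_⟩
  have hmem : u ∈ Ideal.span (Set.range f) := by
    refine hN ((mem_pow_idealOfVars_iff _ _).2 fun x hx => hND.trans ?_)
    rw [Finsupp.degree_eq_weight_one]
    exact (hu (mem_support_iff.1 hx)).ge
  obtain ⟨c, hc⟩ := Ideal.mem_span_range_iff_exists_fun.1 hmem
  refine ⟨fun j => homogeneousComponent (D - m) (c j), fun j => ?_, ?_⟩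
  · have := (homogeneousComponent_isHomogeneous (D - m) (c j)).totalDegree_le
    dsimp only
    omega
  · let _ : GradedAlgebra (homogeneousSubmodule (Fin n) ℂ) := MvPolynomial.gradedAlgebra
    have hcomp : ∀ φ i, (DirectSum.decompose (homogeneousSubmodule (Fin n) ℂ) φ i :
        MvPolynomial (Fin n) ℂ) = homogeneousComponent i φ :=
      fun φ i => decomposition.decompose'_apply φ i
    have hu' : homogeneousComponent D u = u := homogeneousComponent_eq_self hu
    rw [← hu', ← hc, map_sum]
    refine Finset.sum_congr rfl fun j _ => ?_
    dsimp only
    rw [← hcomp, ← hcomp]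
    exact DirectSum.coe_decompose_mul_of_right_mem_of_le
      (homogeneousSubmodule (Fin n) ℂ) (a := c j) (hf j) hmD

lemma MvPolynomial.totalDegree_sub_homogeneousComponent_le {D : ℕ}
    {u : MvPolynomial (Fin n) ℂ} (hu : u.totalDegree ≤ D + 1) :
    (u - homogeneousComponent (D + 1) u).totalDegree ≤ D := by
  refine Finset.sup_le fun x hx => ?_
  rw [mem_support_iff, coeff_sub, coeff_homogeneousComponent] at hx
  split_ifs at hx with h
  · simp at hx
  · have hx' := le_totalDegree (mem_support_iff.2 (by simpa using hx))
    have : x.degree = x.sum fun _ e => e := rfl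
    omega

lemma MvPolynomial.totalDegree_sum_mul_le {ι : Type*} {s : Finset ι}
    {a F : ι → MvPolynomial (Fin n) ℂ} {D : ℕ} (h : ∀ j ∈ s, (a j).totalDegree + (F j).totalDegree ≤ D) :
    (∑ j ∈ s, a j * F j).totalDegree ≤ D :=
  totalDegree_finsetSum_le fun j hj => (totalDegree_mul _ _).trans (h j hj)

/-- Reduction modulo a system of polynomials whose leading forms have no common zero except the
origin: the remainder has bounded degree, and the degrees of the quotients are controlled. -/
lemma MvPolynomial.exists_reduction {m : ℕ} {f F : Fin n → MvPolynomial (Fin n) ℂ}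
    (hf : ∀ j, (f j).IsHomogeneous m) (h0 : ∀ z, (∀ j, eval z (f j) = 0) → z = 0)
    (hF : ∀ j, (F j - f j).totalDegree < m) :
    ∃ N, ∀ D, N ≤ D → ∀ u : MvPolynomial (Fin n) ℂ, u.totalDegree ≤ D →
      ∃ b : Fin n → MvPolynomial (Fin n) ℂ,
        (∀ j, (b j).totalDegree + m ≤ D) ∧ (u - ∑ j, b j * F j).totalDegree ≤ N := by
  obtain ⟨N, hN⟩ := exists_homogeneous_repr hf h0
  refine ⟨max N m, fun D hD => ?_⟩
  induction D, hD using Nat.le_induction with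
  | base => exact fun u hu => ⟨0, by simp, by simpa using hu⟩
  | succ D hD ih =>
    intro u hu
    obtain ⟨b, hb, hub⟩ := hN (D + 1) (by omega) (by omega) (homogeneousComponent (D + 1) u)
      (homogeneousComponent_isHomogeneous _ _)
    have hred : (u - homogeneousComponent (D + 1) u - ∑ j, b j * (F j - f j)).totalDegree ≤ D := by
      refine (totalDegree_sub _ _).trans (max_le (totalDegree_sub_homogeneousComponent_le hu) ?_)
      refine totalDegree_sum_mul_le fun j _ => ?_
      have := hb j
      have := hF j
      omega
    obtain ⟨c, hc, huc⟩ := ih _ hred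
    refine ⟨b + c, fun j => ?_, ?_⟩
    · have := hb j
      have := hc j
      have := totalDegree_add (b j) (c j)
      simp only [Pi.add_apply]
      omega
    · convert huc using 2
      rw [hub]
      simp only [Pi.add_apply, add_mul, mul_sub, Finset.sum_add_distrib, Finset.sum_sub_distrib]
      ring

lemma MvPolynomial.totalDegree_prod_X_sub_C_le (T : Finset ℂ) (i : Fin n) :
    (∏ c ∈ T, (X i - C c : MvPolynomial (Fin n) ℂ)).totalDegree ≤ T.card := by
  refine (totalDegree_finsetProd _ _).trans ?_
  rw [Finset.card_eq_sum_ones]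
  refine Finset.sum_le_sum fun c _ => (totalDegree_sub _ _).trans ?_
  simp [totalDegree_X]

/-- A system with finitely many zeros, all nondegenerate and none at infinity, generates products
of linear forms in each single variable, with optimal degrees of the coefficients. -/
lemma MvPolynomial.exists_prod_X_sub_C_eq_sum {m : ℕ} {f F : Fin n → MvPolynomial (Fin n) ℂ}
    (hf : ∀ j, (f j).IsHomogeneous m) (h0 : ∀ z, (∀ j, eval z (f j) = 0) → z = 0)
    (hF : ∀ j, (F j - f j).totalDegree < m)
    (Z : Finset (Fin n → ℂ)) (hZ : ∀ z, z ∈ Z ↔ ∀ j, eval z (F j) = 0)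
    (hJ : ∀ z ∈ Z, (Matrix.of fun j k => eval z (pderiv k (F j))).det ≠ 0) :
    ∃ T : Finset ℂ, (∀ z ∈ Z, ∀ i, z i ∈ T) ∧ m ≤ T.card ∧
      ∃ a : Fin n → Fin n → MvPolynomial (Fin n) ℂ,
        ∀ i, (∀ j, (a i j).totalDegree + m ≤ T.card) ∧
          ∏ c ∈ T, (X i - C c) = ∑ j, a i j * F j := by
  classical
  obtain ⟨N, hN⟩ := exists_reduction hf h0 hF
  let T₀ : Finset ℂ := Z.biUnion fun z => Finset.univ.image z
  have hT₀ : ∀ z ∈ Z, ∀ i, z i ∈ T₀ := fun z hz i =>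
    Finset.mem_biUnion.2 ⟨z, hz, Finset.mem_image_of_mem _ (Finset.mem_univ i)⟩
  have hmem : ∀ i, ∏ c ∈ T₀, (X i - C c) ∈ Ideal.span (Set.range F) := fun i =>
    mem_span_of_nondegenerate_zeros (fun z hz => hJ z ((hZ z).2 hz)) fun z hz => by
      rw [map_prod]
      exact Finset.prod_eq_zero (hT₀ z ((hZ z).2 hz) i) (by simp)
  choose c hc using fun i => Ideal.mem_span_range_iff_exists_fun.1 (hmem i)
  let E : ℕ := ∑ i, ∑ j, (c i j).totalDegree
  have hE : ∀ i j, (c i j).totalDegree ≤ E := fun i j =>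
    (Finset.single_le_sum (f := fun j => (c i j).totalDegree) (by simp)
      (Finset.mem_univ j)).trans
    (Finset.single_le_sum (f := fun i => ∑ j, (c i j).totalDegree) (by simp)
      (Finset.mem_univ i))
  obtain ⟨T, hT₀T, hT⟩ := Infinite.exists_superset_card_eq T₀ (T₀.card + (N + E + m)) (by omega)
  have hcard : (T \ T₀).card = N + E + m := by
    rw [Finset.card_sdiff_of_subset hT₀T]
    omega
  refine ⟨T, fun z hz i => hT₀T (hT₀ z hz i), by omega, ?_⟩
  have key : ∀ i, ∃ a : Fin n → MvPolynomial (Fin n) ℂ,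
      (∀ j, (a j).totalDegree + m ≤ T.card) ∧ ∏ c ∈ T, (X i - C c) = ∑ j, a j * F j := by
    intro i
    obtain ⟨b, hb, hr⟩ := hN (N + E + m) (by omega) (∏ c ∈ T \ T₀, (X i - C c))
      (hcard ▸ totalDegree_prod_X_sub_C_le _ i)
    set r := ∏ c ∈ T \ T₀, (X i - C c) - ∑ j, b j * F j with hr_def
    refine ⟨fun j => (∏ c ∈ T₀, (X i - C c)) * b j + r * c i j, fun j => ?_, ?_⟩
    · have h₁ := totalDegree_mul (∏ c ∈ T₀, (X i - C c)) (b j)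
      have h₂ := totalDegree_mul r (c i j)
      have h₃ := totalDegree_add ((∏ c ∈ T₀, (X i - C c)) * b j) (r * c i j)
      have h₄ := totalDegree_prod_X_sub_C_le T₀ i
      have := hb j
      have := hE i j
      dsimp only
      omega
    · simp only [add_mul, Finset.sum_add_distrib, mul_assoc, ← Finset.mul_sum, hc]
      rw [← Finset.prod_sdiff hT₀T, hr_def]
      ring
  choose a ha using key
  exact ⟨a, ha⟩

/-- The Euler–Jacobi formula for a grid. -/
lemma MvPolynomial.sum_grid_eq_zero (T : Finset ℂ) {G : MvPolynomial (Fin n) ℂ}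
    (hG : G.totalDegree < n * (T.card - 1)) :
    ∑ e ∈ Fintype.piFinset fun _ : Fin n => T,
      eval e G / ∏ i, ∏ c ∈ T.erase (e i), (e i - c) = 0 := by
  have hswap : ∀ e : Fin n → ℂ, eval e G / ∏ i, ∏ c ∈ T.erase (e i), (e i - c) =
      ∑ d ∈ G.support, coeff d G * ∏ i, e i ^ d i / ∏ c ∈ T.erase (e i), (e i - c) := fun e => by
    rw [eval_eq', Finset.sum_div]
    exact Finset.sum_congr rfl fun d _ => by rw [Finset.prod_div_distrib, mul_div_assoc]
  simp only [hswap]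
  rw [Finset.sum_comm]
  refine Finset.sum_eq_zero fun d hd => ?_
  rw [← Finset.mul_sum, ← Finset.prod_univ_sum (fun _ => T)
    fun i x => x ^ d i / ∏ c ∈ T.erase x, (x - c)]
  have hlt : ∑ i, d i < ∑ _i : Fin n, (T.card - 1) := by
    rw [Finset.sum_const, Finset.card_univ, Fintype.card_fin, smul_eq_mul]
    refine lt_of_le_of_lt ?_ hG
    have := le_totalDegree hd
    rwa [Finsupp.sum_fintype _ _ (by simp)] at this
  obtain ⟨i, -, hi⟩ := Finset.exists_lt_of_sum_lt hlt
  refine mul_eq_zero_of_right _ (Finset.prod_eq_zero (Finset.mem_univ i) ?_)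
  have h := Lagrange.coeff_eq_sum (s := T) (v := id) (Function.injective_id.injOn)
    (P := Polynomial.X ^ d i) (by
      rw [Polynomial.degree_X_pow]
      exact_mod_cast (by omega : d i < T.card))
  rw [Polynomial.coeff_X_pow, if_neg (by omega)] at h
  simpa using h.symm

lemma MvPolynomial.eval_pderiv_prod_X_sub_C {T : Finset ℂ} {e : Fin n → ℂ} {i : Fin n}
    (he : e i ∈ T) (k : Fin n) :
    eval e (pderiv k (∏ c ∈ T, (X i - C c))) =
      if i = k then ∏ c ∈ T.erase (e i), (e i - c) else 0 := by
  rw [← Finset.mul_prod_erase _ _ he, Derivation.leibniz]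
  simp [pderiv_X, Pi.single_apply, map_prod, apply_ite (eval e)]

lemma MvPolynomial.totalDegree_det_le {D : ℕ} (A : Matrix (Fin n) (Fin n) (MvPolynomial (Fin n) ℂ))
    (hA : ∀ i j, (A i j).totalDegree ≤ D) : A.det.totalDegree ≤ n * D := by
  rw [Matrix.det_apply]
  refine totalDegree_finsetSum_le fun σ _ => (totalDegree_smul_le _ _).trans ?_
  refine (totalDegree_finsetProd _ _).trans ?_
  refine (Finset.sum_le_card_nsmul _ _ D fun i _ => hA _ _).trans ?_
  simp

/-- The **Euler–Jacobi vanishing theorem** for a system with finitely many zeros, all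
nondegenerate and none at infinity. -/
theorem MvPolynomial.sum_eval_div_jacobian_eq_zero {m : ℕ} (hm : 1 ≤ m)
    {f F : Fin n → MvPolynomial (Fin n) ℂ}
    (hf : ∀ j, (f j).IsHomogeneous m) (h0 : ∀ z, (∀ j, eval z (f j) = 0) → z = 0)
    (hF : ∀ j, (F j - f j).totalDegree < m)
    (Z : Finset (Fin n → ℂ)) (hZ : ∀ z, z ∈ Z ↔ ∀ j, eval z (F j) = 0)
    (hJ : ∀ z ∈ Z, (Matrix.of fun j k => eval z (pderiv k (F j))).det ≠ 0)
    {h : MvPolynomial (Fin n) ℂ} (hh : h.totalDegree < n * (m - 1)) :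
    ∑ z ∈ Z, eval z h / (Matrix.of fun j k => eval z (pderiv k (F j))).det = 0 := by
  obtain ⟨T, hZT, hmT, a, ha⟩ := exists_prod_X_sub_C_eq_sum hf h0 hF Z hZ hJ
  let A : Matrix (Fin n) (Fin n) (MvPolynomial (Fin n) ℂ) := Matrix.of a
  have hdeg : (A.det * h).totalDegree < n * (T.card - 1) := by
    have h₁ : A.det.totalDegree ≤ n * (T.card - m) := totalDegree_det_le A fun i j => by
      have := (ha i).1 j
      simp only [A, Matrix.of_apply]
      omega
    have h₂ : T.card - 1 = (T.card - m) + (m - 1) := by omega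
    have h₃ := totalDegree_mul A.det h
    rw [h₂, mul_add]
    omega
  rw [← sum_grid_eq_zero T hdeg]
  have hsub : Z ⊆ Fintype.piFinset fun _ : Fin n => T := fun z hz =>
    Fintype.mem_piFinset.2 fun i => hZT z hz i
  have hdetA : ∀ e, eval e A.det = (Matrix.of fun i j => eval e (a i j)).det := fun e => by
    rw [RingHom.map_det]
    rfl
  refine (Finset.sum_congr rfl fun e he => ?_).trans
    (Finset.sum_subset hsub fun e he heZ => ?_)
  · have hmul : (Matrix.of fun i j => eval e (a i j)) *
        (Matrix.of fun j k => eval e (pderiv k (F j))) =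
        Matrix.diagonal fun i => ∏ c ∈ T.erase (e i), (e i - c) := by
      ext i k
      rw [Matrix.diagonal_apply, ← eval_pderiv_prod_X_sub_C (hZT e he i) k, (ha i).2,
        eval_pderiv_sum_mul _ _ _ _ ((hZ e).1 he), Matrix.mul_apply]
      rfl
    have hdet := congrArg Matrix.det hmul
    rw [Matrix.det_mul, Matrix.det_diagonal] at hdet
    have hne : ∏ i, ∏ c ∈ T.erase (e i), (e i - c) ≠ 0 :=
      Finset.prod_ne_zero_iff.2 fun i _ => Finset.prod_ne_zero_iff.2 fun c hc =>
        sub_ne_zero.2 (Finset.ne_of_mem_erase hc).symm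
    rw [← hdet] at hne ⊢
    rw [map_mul, hdetA, mul_div_mul_left _ _ (left_ne_zero_of_mul hne)]
  · have hker : (Matrix.of fun i j => eval e (a i j)).det = 0 := by
      refine Matrix.exists_mulVec_eq_zero_iff.1 ⟨fun j => eval e (F j), fun hz => ?_, ?_⟩
      · exact heZ ((hZ e).2 fun j => congrFun hz j)
      · funext i
        have hei := congrArg (eval e) (ha i).2
        rw [map_prod, Finset.prod_eq_zero (Fintype.mem_piFinset.1 he i) (by simp)] at hei
        simpa [Matrix.mulVec, dotProduct] using hei.symm
    rw [map_mul, hdetA, hker, zero_mul, zero_div]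

end EulerJacobi

section Darboux

variable {n k : ℕ}

lemma MvPolynomial.totalDegree_prod_sub_prod_le {ι : Type*} (s : Finset ι) {D : ℕ}
    {u v : ι → MvPolynomial (Fin n) ℂ} (hu : ∀ i, (u i).totalDegree ≤ D)
    (hv : ∀ i, (v i).totalDegree ≤ D) (huv : ∀ i, (u i - v i).totalDegree = 0) :
    (∏ i ∈ s, u i - ∏ i ∈ s, v i).totalDegree ≤ (s.card - 1) * D := by
  classical
  induction s using Finset.induction_on with
  | empty => simp
  | insert a s ha ih =>
    rw [Finset.prod_insert ha, Finset.prod_insert ha, Finset.card_insert_of_notMem ha,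
      Nat.add_sub_cancel]
    have hsplit : u a * ∏ i ∈ s, u i - v a * ∏ i ∈ s, v i =
        (u a - v a) * ∏ i ∈ s, u i + v a * (∏ i ∈ s, u i - ∏ i ∈ s, v i) := by ring
    rw [hsplit]
    refine (totalDegree_add _ _).trans (max_le ?_ ?_)
    · refine (totalDegree_mul _ _).trans ?_
      rw [huv, zero_add]
      refine (totalDegree_finsetProd _ _).trans ?_
      exact (Finset.sum_le_card_nsmul _ _ D fun i _ => hu i).trans_eq (smul_eq_mul _ _)
    · rcases s.eq_empty_or_nonempty with rfl | hs
      · simp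
      · refine (totalDegree_mul _ _).trans ((add_le_add (hv a) ih).trans_eq ?_)
        obtain ⟨c, hc⟩ := Nat.exists_eq_add_of_le' hs.card_pos
        rw [hc, Nat.add_sub_cancel]
        ring

/-- Changing a polynomial matrix by constants affects its determinant only in lower degrees. -/
lemma MvPolynomial.totalDegree_det_sub_det_le {D : ℕ}
    {A B : Matrix (Fin n) (Fin n) (MvPolynomial (Fin n) ℂ)}
    (hA : ∀ i j, (A i j).totalDegree ≤ D) (hB : ∀ i j, (B i j).totalDegree ≤ D)
    (hAB : ∀ i j, (A i j - B i j).totalDegree = 0) :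
    (A.det - B.det).totalDegree ≤ (n - 1) * D := by
  rw [Matrix.det_apply, Matrix.det_apply, ← Finset.sum_sub_distrib]
  refine totalDegree_finsetSum_le fun σ _ => ?_
  rw [← smul_sub]
  refine (totalDegree_smul_le _ _).trans ?_
  simpa using totalDegree_prod_sub_prod_le Finset.univ (u := fun i => A (σ i) i)
    (v := fun i => B (σ i) i) (fun i => hA _ _) (fun i => hB _ _) (fun i => hAB _ _)

lemma vecMul_hess_eq_smul {V : MvPolynomial (Fin n) ℂ} (hV : V.IsHomogeneous k)
    (d : Fin n → ℂ) : Matrix.vecMul d (hess V d) = ((k - 1 : ℕ) : ℂ) • grad V d := by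
  funext j
  have h := congrArg (eval d) (hV.pderiv (i := j)).sum_X_mul_pderiv
  simpa [Matrix.vecMul, dotProduct, hess, grad] using h

lemma det_hess_sub_eq_zero {V : MvPolynomial (Fin n) ℂ} (hV : V.IsHomogeneous k) {d : Fin n → ℂ}
    (hd : d ≠ 0) (hgrad : grad V d = d) :
    (hess V d - ((k - 1 : ℕ) : ℂ) • (1 : Matrix (Fin n) (Fin n) ℂ)).det = 0 := by
  refine Matrix.exists_vecMul_eq_zero_iff.1 ⟨d, hd, ?_⟩
  rw [Matrix.vecMul_sub, vecMul_hess_eq_smul hV, hgrad, Matrix.vecMul_smul, Matrix.vecMul_one,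
    sub_self]

lemma MvPolynomial.IsHomogeneous.eval_zero_eq_zero {p : MvPolynomial (Fin n) ℂ}
    (hp : p.IsHomogeneous k) (hk : k ≠ 0) : eval 0 p = 0 := by
  rw [eval_zero, constantCoeff_eq]
  by_contra hne
  exact hk (by simpa using (hp hne).symm)

lemma hess_zero (hk : 2 < k) {V : MvPolynomial (Fin n) ℂ} (hV : V.IsHomogeneous k) :
    hess V 0 = 0 := by
  ext i j
  exact hV.pderiv.pderiv.eval_zero_eq_zero (by omega)

lemma grad_zero (hk : 2 < k) {V : MvPolynomial (Fin n) ℂ} (hV : V.IsHomogeneous k) :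
    grad V 0 = 0 :=
  funext fun _ => hV.pderiv.eval_zero_eq_zero (by omega)

/-- The Euler–Jacobi relation for the shifted Hessian determinants at the Darboux points. -/
lemma sum_det_hess_sub_div (hn : 2 ≤ n) (hk : 2 < k) {V : MvPolynomial (Fin n) ℂ}
    (hV : V.IsHomogeneous k) (hproper : ∀ d : Fin n → ℂ, grad V d = 0 → d = 0)
    (S : Finset (Fin n → ℂ)) (hS : ∀ d, d ∈ S ↔ d ≠ 0 ∧ grad V d = d)
    (hsimple : ∀ d ∈ S, (hess V d - 1).det ≠ 0) (t : ℂ) :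
    ∑ d ∈ S, (hess V d - t • (1 : Matrix (Fin n) (Fin n) ℂ)).det / (hess V d - 1).det =
      ((k - 1 : ℕ) : ℂ) ^ n - t ^ n := by
  classical
  let H : ℂ → Matrix (Fin n) (Fin n) (MvPolynomial (Fin n) ℂ) := fun t =>
    Matrix.of fun i j => pderiv i (pderiv j V) - C ((t • (1 : Matrix (Fin n) (Fin n) ℂ)) i j)
  have hH : ∀ t i j, (H t i j).totalDegree ≤ k - 2 := fun t i j => by
    refine (totalDegree_sub _ _).trans (max_le ?_ (by rw [totalDegree_C]; omega))
    exact ((hV.pderiv (i := j)).pderiv (i := i)).totalDegree_le.trans_eq (by omega)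
  have hHdet : ∀ t d, eval d (H t).det = (hess V d - t • (1 : Matrix (Fin n) (Fin n) ℂ)).det := by
    intro t d
    rw [RingHom.map_det]
    congr 1
    ext i j
    simp [H, hess]
  have hdeg : ((H t).det - (H ((k - 1 : ℕ) : ℂ)).det).totalDegree < n * (k - 1 - 1) := by
    refine (totalDegree_det_sub_det_le (hH _) (hH _) fun i j => ?_).trans_lt ?_
    · simp only [H, Matrix.of_apply, sub_sub_sub_cancel_left, ← C_sub, totalDegree_C]
    · rw [Nat.sub_sub]
      exact Nat.mul_lt_mul_of_pos_right (by omega) (by omega)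
  have hjac : ∀ z, (Matrix.of fun j l => eval z (pderiv l (pderiv j V - X j))).det =
      (hess V z - 1).det := fun z => by
    rw [← Matrix.det_transpose]
    congr 1
    ext i j
    simp [hess, pderiv_X, Pi.single_apply, Matrix.one_apply, apply_ite (eval z), eq_comm]
  have h00 : (hess V 0 - 1).det = (-1) ^ n := by
    rw [hess_zero hk hV, zero_sub, Matrix.det_neg]
    simp
  have h0S : (0 : Fin n → ℂ) ∉ S := fun h => ((hS 0).1 h).1 rfl
  have key := sum_eval_div_jacobian_eq_zero (m := k - 1) (by omega)
    (f := fun j => pderiv j V) (F := fun j => pderiv j V - X j) (fun j => hV.pderiv)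
    (fun z hz => hproper z (funext hz))
    (fun j => by
      rw [sub_sub_cancel_left, totalDegree_neg, totalDegree_X]
      omega)
    (insert 0 S)
    (fun z => by
      have hz : (∀ j, eval z (pderiv j V - X j) = 0) ↔ grad V z = z := by
        simp only [map_sub, eval_X, sub_eq_zero]
        exact _root_.funext_iff.symm
      rw [hz, Finset.mem_insert, hS]
      by_cases h : z = 0
      · simp [h, grad_zero hk hV]
      · simp [h])
    (fun z hz => by
      rw [hjac]
      rcases Finset.mem_insert.1 hz with rfl | hz
      · rw [h00]
        exact pow_ne_zero _ (by norm_num)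
      · exact hsimple z hz) hdeg
  simp only [hjac] at key
  simp only [map_sub, hHdet] at key
  rw [Finset.sum_insert h0S, h00, hess_zero hk hV] at key
  have hrest : ∀ d ∈ S, ((hess V d - t • (1 : Matrix (Fin n) (Fin n) ℂ)).det -
      (hess V d - ((k - 1 : ℕ) : ℂ) • (1 : Matrix (Fin n) (Fin n) ℂ)).det) / (hess V d - 1).det =
      (hess V d - t • (1 : Matrix (Fin n) (Fin n) ℂ)).det / (hess V d - 1).det := fun d hd => by
    rw [det_hess_sub_eq_zero hV ((hS d).1 hd).1 ((hS d).1 hd).2, sub_zero]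
  rw [Finset.sum_congr rfl hrest] at key
  simp only [zero_sub, Matrix.det_neg, Matrix.det_smul, Matrix.det_one, Fintype.card_fin,
    mul_one] at key
  rw [← mul_sub, mul_div_cancel_left₀ _ (pow_ne_zero _ (by norm_num))] at key
  linear_combination key

lemma charpoly_roots_eq_cons_shiftedSpectrum (hk : 2 < k) {V : MvPolynomial (Fin n) ℂ}
    (hV : V.IsHomogeneous k) {d : Fin n → ℂ} (hd : d ≠ 0) (hgrad : grad V d = d) :
    (hess V d - 1).charpoly.roots = ((k : ℂ) - 2) ::ₘ shiftedSpectrum k V d := by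
  refine (Multiset.cons_erase ?_).symm
  rw [Polynomial.mem_roots (Matrix.charpoly_monic _).ne_zero, Polynomial.IsRoot.def,
    Matrix.eval_charpoly]
  have h := det_hess_sub_eq_zero hV hd hgrad
  rw [← neg_sub, Matrix.det_neg, mul_eq_zero] at h
  rw [← h.resolve_left (pow_ne_zero _ (by norm_num))]
  congr 1
  rw [Nat.cast_sub (by omega)]
  ext i j
  by_cases hij : i = j
  · subst hij
    simp
    ring
  · simp [hij]

lemma card_shiftedSpectrum (hk : 2 < k) {V : MvPolynomial (Fin n) ℂ}
    (hV : V.IsHomogeneous k) {d : Fin n → ℂ} (hd : d ≠ 0) (hgrad : grad V d = d) :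
    (shiftedSpectrum k V d).card = n - 1 := by
  have h := congrArg Multiset.card (charpoly_roots_eq_cons_shiftedSpectrum hk hV hd hgrad)
  rw [← (IsAlgClosed.splits _).natDegree_eq_card_roots, Matrix.charpoly_natDegree_eq_dim,
    Multiset.card_cons, Fintype.card_fin] at h
  omega

lemma det_hess_sub_eq_prod (hk : 2 < k) {V : MvPolynomial (Fin n) ℂ}
    (hV : V.IsHomogeneous k) {d : Fin n → ℂ} (hd : d ≠ 0) (hgrad : grad V d = d) (s : ℂ) :
    (hess V d - (1 - s) • (1 : Matrix (Fin n) (Fin n) ℂ)).det =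
      (s + (k - 2)) * ((shiftedSpectrum k V d).map fun x => s + x).prod := by
  have hroots := charpoly_roots_eq_cons_shiftedSpectrum hk hV hd hgrad
  have hcard : (hess V d - 1).charpoly.roots.card = n := by
    rw [← (IsAlgClosed.splits _).natDegree_eq_card_roots, Matrix.charpoly_natDegree_eq_dim,
      Fintype.card_fin]
  have h := Matrix.eval_charpoly (hess V d - 1) (-s)
  rw [(IsAlgClosed.splits (hess V d - 1).charpoly).eq_prod_roots_of_monic
    (Matrix.charpoly_monic _), Polynomial.eval_multiset_prod, Multiset.map_map] at h
  have hneg : Matrix.scalar (Fin n) (-s) - (hess V d - 1) =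
      -(hess V d - (1 - s) • (1 : Matrix (Fin n) (Fin n) ℂ)) := by
    ext i j
    by_cases hij : i = j
    · subst hij
      simp
      ring
    · simp [hij]
  have hprod : ((hess V d - 1).charpoly.roots.map fun x => -(s + x)).prod =
      (-1) ^ n * ((hess V d - 1).charpoly.roots.map fun x => s + x).prod := by
    simp only [← neg_one_mul (s + _)]
    rw [Multiset.prod_map_mul, Multiset.map_const', Multiset.prod_replicate, hcard]
  have hcomp : (Polynomial.eval (-s) ∘ fun a => Polynomial.X - Polynomial.C a) =
      fun x => -(s + x) := by
    funext x
    simp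
    ring
  rw [hcomp, hprod, hneg, Matrix.det_neg, Fintype.card_fin] at h
  rw [← mul_left_cancel₀ (pow_ne_zero _ (by norm_num)) h, hroots, Multiset.map_cons,
    Multiset.prod_cons]

lemma Polynomial.coeff_one_sub_X_pow (a b : ℕ) :
    ((1 - X : Polynomial ℂ) ^ a).coeff b = (-1) ^ b * (a.choose b : ℂ) := by
  have h : (1 - X : Polynomial ℂ) = (1 + X : Polynomial ℂ).comp (C (-1) * X) := by
    simp [sub_eq_add_neg]
  rw [h, ← pow_comp, comp_C_mul_X_coeff, coeff_one_add_X_pow, mul_comm]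
/-- The generating polynomial of the sums over the Darboux points. -/
lemma sum_prod_shiftedSpectrum (hn : 2 ≤ n) (hk : 2 < k) {V : MvPolynomial (Fin n) ℂ}
    (hV : V.IsHomogeneous k) (hproper : ∀ d : Fin n → ℂ, grad V d = 0 → d = 0)
    (S : Finset (Fin n → ℂ)) (hS : ∀ d, d ∈ S ↔ d ≠ 0 ∧ grad V d = d)
    (hsimple : ∀ d ∈ S, (hess V d - 1).det ≠ 0) :
    ∑ d ∈ S, Polynomial.C (hess V d - 1).det⁻¹ *
        ((shiftedSpectrum k V d).map fun x => Polynomial.X + Polynomial.C x).prod =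
      ∑ i ∈ Finset.range n,
        Polynomial.C (((k : ℂ) - 1) ^ i) * (1 - Polynomial.X) ^ (n - 1 - i) := by
  refine mul_left_cancel₀ (Polynomial.X_add_C_ne_zero ((k : ℂ) - 2)) (Polynomial.funext fun s => ?_)
  have h := sum_det_hess_sub_div hn hk hV hproper S hS hsimple (1 - s)
  rw [Nat.cast_sub (by omega), Nat.cast_one, ← Commute.mul_geom_sum₂ (Commute.all _ _)] at h
  simp only [Polynomial.eval_mul, Polynomial.eval_add, Polynomial.eval_X, Polynomial.eval_C,
    Polynomial.eval_finsetSum, Polynomial.eval_pow, Polynomial.eval_sub, Polynomial.eval_one]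
  have hfac : (k : ℂ) - 1 - (1 - s) = s + (k - 2) := by ring
  rw [hfac] at h
  rw [← h, Finset.mul_sum]
  refine Finset.sum_congr rfl fun d hd => ?_
  rw [det_hess_sub_eq_prod hk hV ((hS d).1 hd).1 ((hS d).1 hd).2, Polynomial.eval_multiset_prod,
    Multiset.map_map]
  have hcomp : (Polynomial.eval s ∘ fun x => Polynomial.X + Polynomial.C x) =
      fun x => s + x := by
    funext x
    simp
  rw [hcomp]
  ring

lemma det_hess_sub_one_eq (hk : 2 < k) {V : MvPolynomial (Fin n) ℂ}
    (hV : V.IsHomogeneous k) {d : Fin n → ℂ} (hd : d ≠ 0) (hgrad : grad V d = d) :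
    (hess V d - 1).det = ((k : ℂ) - 2) * (shiftedSpectrum k V d).esymm (n - 1) := by
  have h := det_hess_sub_eq_prod hk hV hd hgrad 0
  have hc := Multiset.prod_X_add_C_coeff (shiftedSpectrum k V d) (Nat.zero_le _)
  rw [Nat.sub_zero, card_shiftedSpectrum hk hV hd hgrad, Polynomial.coeff_zero_eq_eval_zero,
    Polynomial.eval_multiset_prod, Multiset.map_map] at hc
  rw [← hc]
  simpa using h

end Darboux

/-- Second family of universal relations among the Darboux-point eigenvalues of a generic
homogeneous potential:
`Σ_{d∈S} τ_r(Λ(d)) / τ_{n−1}(Λ(d)) = (k−2)·(−1)^{r+n−1}·Σ_{i=0}^{r} C(n−i−1, r−i)·(k−1)^i`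
for `r = 0,…,n−1`, where `S` is the set of normalized proper Darboux points (each
projective Darboux point contributing `k−2` elements of `S`). -/
theorem stmt11 {n k : ℕ} (hn : 2 ≤ n) (hk : 2 < k)
    (V : MvPolynomial (Fin n) ℂ) (hV : V.IsHomogeneous k)
    (hproper : ∀ d : Fin n → ℂ, grad V d = 0 → d = 0)
    (S : Set (Fin n → ℂ)) (hSdef : S = {d | d ≠ 0 ∧ grad V d = d})
    (hfin : S.Finite)
    (hsimple : ∀ d ∈ S, Matrix.det (hess V d - 1) ≠ 0) :
    ∀ r < n,
      ∑ d ∈ hfin.toFinset,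
          (shiftedSpectrum k V d).esymm r / (shiftedSpectrum k V d).esymm (n - 1) =
        ((k : ℂ) - 2) * (-1) ^ (r + n - 1) *
          ∑ i ∈ Finset.range (r + 1),
            (Nat.choose (n - i - 1) (r - i) : ℂ) * ((k : ℂ) - 1) ^ i := by
  intro r hr
  have hS : ∀ d, d ∈ hfin.toFinset ↔ d ≠ 0 ∧ grad V d = d := fun d => by
    rw [Set.Finite.mem_toFinset, hSdef]
    rfl
  have key := congrArg (fun p => Polynomial.coeff p (n - 1 - r))
    (sum_prod_shiftedSpectrum hn hk hV hproper hfin.toFinset hS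
      fun d hd => hsimple d (hfin.mem_toFinset.1 hd))
  simp only [Polynomial.finsetSum_coeff, Polynomial.coeff_C_mul,
    Polynomial.coeff_one_sub_X_pow] at key
  have hk2 : (k : ℂ) - 2 ≠ 0 := sub_ne_zero.2 (by exact_mod_cast hk.ne')
  have hterm : ∀ d ∈ hfin.toFinset,
      (shiftedSpectrum k V d).esymm r / (shiftedSpectrum k V d).esymm (n - 1) =
        ((k : ℂ) - 2) * ((hess V d - 1).det⁻¹ *
          (((shiftedSpectrum k V d).map fun x =>
            Polynomial.X + Polynomial.C x).prod).coeff (n - 1 - r)) := fun d hd => by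
    have hcard := card_shiftedSpectrum hk hV ((hS d).1 hd).1 ((hS d).1 hd).2
    rw [det_hess_sub_one_eq hk hV ((hS d).1 hd).1 ((hS d).1 hd).2,
      Multiset.prod_X_add_C_coeff _ (by omega), hcard,
      show n - 1 - (n - 1 - r) = r by omega, mul_inv, mul_assoc, mul_inv_cancel_left₀ hk2,
      div_eq_inv_mul]
  rw [Finset.sum_congr rfl hterm, ← Finset.mul_sum, key, mul_assoc]
  congr 1
  rw [Finset.mul_sum]
  refine (Finset.sum_subset (Finset.range_subset_range.2 (by omega : r + 1 ≤ n))
    fun i hin hi => ?_).symm.trans (Finset.sum_congr rfl fun i hi => ?_)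
  · rw [Finset.mem_range] at hin hi
    rw [Nat.choose_eq_zero_of_lt (by omega)]
    simp
  · have hir : i ≤ r := Nat.lt_succ_iff.1 (Finset.mem_range.1 hi)
    rw [show r + n - 1 = (n - 1 - r) + 2 * r by omega, pow_add, pow_mul, neg_one_sq, one_pow,
      mul_one, ← Nat.choose_symm (by omega : r - i ≤ n - i - 1),
      show n - i - 1 - (r - i) = n - 1 - r by omega, Nat.sub_right_comm n i 1]
    ring
end

section
/- Let n ≥ 2, k > 2, and let F = (F₁,…,Fₙ) with each Fᵢ ∈ ℂ[q₁,…,qₙ] homogeneous of degree k−1 (a homogeneous force, not necessarily potential). Assume all Darboux points of F are proper and simple, i.e.: (i) F(d) = 0 with d parallel to F(d) and d ≠ 0 does not occur — every nonzero d with d ∧ F(d) = 0 has F(d) ≠ 0; (ii) for every d in the finite set S := {d ∈ ℂⁿ ∖ {0} : F(d) = d}, det(F′(d) − 1) ≠ 0, where F′(d) is the Jacobian matrix (∂Fᵢ/∂qⱼ(d)). For d ∈ S let Λ(d) be the multiset of roots of the characteristic polynomial of F′(d) − 1 with one copy of the trivial root k−2 removed (by Euler's identity F′(d)·d = (k−1)F(d)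 = (k−1)d, so k−1 is always an eigenvalue of F′(d)). Then for every r = 0,…,n−1: Σ_{d∈S} τ₁(Λ(d))^r / τ_{n−1}(Λ(d)) = (k−2)·(−1)^{n−1+r}·(n+k−2)^r, and Σ_{d∈S} τ_r(Λ(d)) / τ_{n−1}(Λ(d)) = (k−2)·(−1)^{r+1−n}·Σ_{i=0}^{r} C(n−i−1, r−i)·(k−1)^{i}. -/
open MvPolynomial

/-- Evaluation of a polynomial force `F = (F₁,…,Fₙ)` at a point. -/
noncomputable def forceEval {n : ℕ} (F : Fin n → MvPolynomial (Fin n) ℂ)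
    (d : Fin n → ℂ) : Fin n → ℂ :=
  fun i => eval d (F i)

/-- The Jacobian matrix `F'(d) = (∂Fᵢ/∂qⱼ(d))` of a polynomial force. -/
noncomputable def forceJac {n : ℕ} (F : Fin n → MvPolynomial (Fin n) ℂ)
    (d : Fin n → ℂ) : Matrix (Fin n) (Fin n) ℂ :=
  Matrix.of fun i j => eval d (pderiv j (F i))

/-- The multiset `Λ(d)` of shifted nontrivial eigenvalues at a normalized proper Darboux
point of a force: the roots of the characteristic polynomial of `F'(d) − 1` (counted with
multiplicity) with one copy of the trivial root `k−2` removed. -/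
noncomputable def shiftedSpectrumF {n : ℕ} (k : ℕ) (F : Fin n → MvPolynomial (Fin n) ℂ)
    (d : Fin n → ℂ) : Multiset ℂ :=
  ((forceJac F d - 1).charpoly.roots).erase ((k : ℂ) - 2)

theorem totalDegree_det_le {ι σ R : Type*} [Fintype ι] [DecidableEq ι] [CommRing R]
    (A : Matrix ι ι (MvPolynomial σ R)) (b : ι → ℕ) (h : ∀ i j, (A i j).totalDegree ≤ b i) :
    A.det.totalDegree ≤ ∑ i, b i := by
  rw [Matrix.det_apply]
  refine totalDegree_finsetSum_le fun s _ => ?_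
  have h1 : (∏ i, A (s i) i).totalDegree ≤ ∑ i, b i :=
    calc (∏ i, A (s i) i).totalDegree ≤ ∑ i, (A (s i) i).totalDegree :=
          totalDegree_finsetProd _ _
      _ ≤ ∑ i, b (s i) := Finset.sum_le_sum fun i _ => h _ _
      _ = ∑ i, b i := Equiv.sum_comp s b
  exact (totalDegree_smul_le _ _).trans h1

/-- The exponent vector all of whose entries equal `m`. -/
noncomputable def constExp (ι : Type*) [Finite ι] (m : ℕ) : ι →₀ ℕ :=
  Finsupp.equivFunOnFinite.symm fun _ => m

theorem degree_constExp {ι : Type*} [Fintype ι] (m : ℕ) :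
    (constExp ι m).degree = Fintype.card ι * m := by
  simp [constExp, Finsupp.degree_eq_sum]

theorem coeff_eq_zero_of_totalDegree_lt_degree {σ R : Type*} [CommRing R]
    {g : MvPolynomial σ R} {s : σ →₀ ℕ} (h : g.totalDegree < s.degree) : coeff s g = 0 :=
  coeff_eq_zero_of_totalDegree_lt h

theorem coeff_constExp_det_eq_zero {ι R : Type*} [Fintype ι] [DecidableEq ι] [CommRing R]
    {m : ℕ} (N : Matrix ι ι (MvPolynomial ι R)) (hN : ∀ i j, (N i j).totalDegree ≤ m) (j : ι)
    (hj : (∑ l, N j l * X l).totalDegree ≤ m)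
    (hne : ∀ i ≠ j, (∑ l, N i l * X l - X i ^ (m + 1)).totalDegree ≤ m) :
    coeff (constExp ι m) N.det = 0 := by
  have key : X j * N.det = ∑ i, N.adjugate j i * ∑ l, N i l * X l := by
    have h := congrArg (fun A => Matrix.mulVec A (X : ι → MvPolynomial ι R) j)
      (Matrix.adjugate_mul N)
    simp only [← Matrix.mulVec_mulVec, Matrix.smul_mulVec, Matrix.one_mulVec] at h
    simp only [Matrix.mulVec, dotProduct, Pi.smul_apply, smul_eq_mul] at h
    rw [h, mul_comm]
  have hcard : 0 < Fintype.card ι := Fintype.card_pos_iff.2 ⟨j⟩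
  have hadj : ∀ i, (N.adjugate j i).totalDegree ≤ (Fintype.card ι - 1) * m := by
    intro i
    rw [Matrix.adjugate_apply]
    refine (totalDegree_det_le _ (Function.update (fun _ => m) i 0) ?_).trans ?_
    · intro a b
      by_cases h : a = i
      · subst h
        simp only [Matrix.updateRow_self, Function.update_self, Pi.single_apply]
        split_ifs <;> simp
      · simpa [Matrix.updateRow_ne h, h] using hN a b
    · rw [Finset.sum_update_of_mem (Finset.mem_univ _)]
      simp [Finset.card_sdiff]
  have hlow : ∀ i (q : MvPolynomial ι R), q.totalDegree ≤ m →
      coeff (Finsupp.single j 1 + constExp ι m) (N.adjugate j i * q) = 0 := by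
    intro i q hq
    apply coeff_eq_zero_of_totalDegree_lt_degree
    refine (totalDegree_mul _ _).trans_lt ?_
    have h1 : (Fintype.card ι - 1) * m + m = Fintype.card ι * m := by
      rw [← Nat.succ_mul, Nat.succ_eq_add_one, Nat.sub_add_cancel hcard]
    have h2 : (Finsupp.single j 1 + constExp ι m).degree = 1 + Fintype.card ι * m := by
      rw [map_add, degree_constExp, Finsupp.degree_single]
    have := hadj i
    omega
  rw [← coeff_X_mul (constExp ι m) j, key, coeff_sum]
  refine Finset.sum_eq_zero fun i _ => ?_
  by_cases h : i = j
  · subst h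
    exact hlow i _ hj
  · rw [← sub_add_cancel (∑ l, N i l * X l) (X i ^ (m + 1)), mul_add, coeff_add,
      hlow i _ (hne i h), zero_add, X_pow_eq_monomial, coeff_mul_monomial', if_neg]
    intro hle
    have := hle i
    simp [constExp, Ne.symm h] at this

theorem coeff_constExp_det_eq {ι R : Type*} [Fintype ι] [DecidableEq ι] [CommRing R]
    {m : ℕ} (E E' : Matrix ι ι (MvPolynomial ι R))
    (hE : ∀ i j, (E i j).totalDegree ≤ m) (hE' : ∀ i j, (E' i j).totalDegree ≤ m)
    (h : ∀ i, (∑ l, E i l * X l - X i ^ (m + 1)).totalDegree ≤ m)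
    (h' : ∀ i, (∑ l, E' i l * X l - X i ^ (m + 1)).totalDegree ≤ m) :
    coeff (constExp ι m) E.det = coeff (constExp ι m) E'.det := by
  set P : Finset ι → Matrix ι ι (MvPolynomial ι R) :=
    fun s => Matrix.of fun i k => if i ∈ s then E i k else E' i k with hP
  have hmem : ∀ s, ∀ i ∈ s, ∀ k, P s i k = E i k := fun s i hi k => by simp [hP, hi]
  have hnotMem : ∀ s, ∀ i ∉ s, ∀ k, P s i k = E' i k := fun s i hi k => by simp [hP, hi]
  suffices H : ∀ s : Finset ι, coeff (constExp ι m) (P s).det = coeff (constExp ι m) E'.det by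
    have h1 : P Finset.univ = E := by ext1 i k; exact hmem _ _ (Finset.mem_univ _) _
    rw [← H Finset.univ, h1]
  intro s
  induction s using Finset.induction_on with
  | empty =>
    have h1 : P ∅ = E' := by ext1 i k; exact hnotMem _ _ (Finset.notMem_empty _) _
    rw [h1]
  | insert j s hjs ih =>
    rw [← ih, ← sub_eq_zero, ← coeff_sub]
    have hins : P (insert j s) = (P s).updateRow j ((fun k => E j k - E' j k) + P s j) := by
      ext1 i k
      by_cases hi : i = j
      · subst hi
        simp [hmem _ _ (Finset.mem_insert_self i s), hnotMem _ _ hjs]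
      · rw [Matrix.updateRow_ne hi]
        simp [hP, hi]
    have hdet : (P (insert j s)).det - (P s).det =
        ((P s).updateRow j (fun k => E j k - E' j k)).det := by
      rw [hins, Matrix.det_updateRow_add, Matrix.updateRow_eq_self, add_sub_cancel_right]
    rw [hdet]
    refine coeff_constExp_det_eq_zero _ ?_ j ?_ ?_
    · intro i k
      by_cases hi : i = j
      · subst hi
        simp only [Matrix.updateRow_self]
        exact (totalDegree_sub _ _).trans (max_le (hE _ _) (hE' _ _))
      · rw [Matrix.updateRow_ne hi]
        by_cases his : i ∈ s
        · rw [hmem _ _ his]; exact hE i k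
        · rw [hnotMem _ _ his]; exact hE' i k
    · have : ∑ l, (P s).updateRow j (fun k => E j k - E' j k) j l * X l =
          (∑ l, E j l * X l - X j ^ (m + 1)) - (∑ l, E' j l * X l - X j ^ (m + 1)) := by
        simp [sub_mul]
      rw [this]
      exact (totalDegree_sub _ _).trans (max_le (h _) (h' _))
    · intro i hi
      simp only [Matrix.updateRow_ne hi]
      by_cases his : i ∈ s
      · simp only [hmem _ _ his]; exact h i
      · simp only [hnotMem _ _ his]; exact h' i

theorem coeff_constExp_det_eq_one {ι R : Type*} [Fintype ι] [DecidableEq ι] [CommRing R]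
    {m : ℕ} (E : Matrix ι ι (MvPolynomial ι R))
    (hE : ∀ i j, (E i j).totalDegree ≤ m)
    (h : ∀ i, (∑ l, E i l * X l - X i ^ (m + 1)).totalDegree ≤ m) :
    coeff (constExp ι m) E.det = 1 := by
  have hXm : ∀ i : ι, (X i ^ m : MvPolynomial ι R).totalDegree ≤ m := fun i =>
    (isHomogeneous_X_pow i m).totalDegree_le
  rw [coeff_constExp_det_eq E (Matrix.diagonal fun i => X i ^ m) hE ?_ h ?_]
  · have : (∏ i : ι, X i ^ m : MvPolynomial ι R) = monomial (constExp ι m) 1 := by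
      rw [monomial_eq, Finsupp.prod_fintype _ _ (by simp)]
      simp [constExp]
    rw [Matrix.det_diagonal, this, coeff_monomial, if_pos rfl]
  · intro i j
    rw [Matrix.diagonal_apply]
    split_ifs
    · exact hXm i
    · simp
  · intro i
    simp [Matrix.diagonal_apply, pow_succ]

theorem totalDegree_prod_pow_le {ι σ R : Type*} [Fintype ι] [CommRing R]
    {m : ℕ} (l : ι → MvPolynomial σ R) (hl : ∀ i, (l i).totalDegree ≤ m) (k : ι → ℕ) :
    (∏ i, l i ^ k i).totalDegree ≤ (∑ i, k i) * m := by
  rw [Finset.sum_mul]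
  exact (totalDegree_finsetProd _ _).trans (Finset.sum_le_sum fun i _ =>
    (totalDegree_pow _ _).trans (Nat.mul_le_mul_left _ (hl i)))

theorem coeff_mul_prod_pow_eq_zero {ι R : Type*} [Fintype ι] [CommRing R]
    {m : ℕ} (l : ι → MvPolynomial ι R) (hl : ∀ i, (l i).totalDegree ≤ m)
    (g : MvPolynomial ι R) (k : ι → ℕ)
    (h : g.totalDegree < Fintype.card ι * m + ∑ i, k i) :
    coeff ((m + 1) • Finsupp.equivFunOnFinite.symm k + constExp ι m)
      (g * ∏ i, l i ^ k i) = 0 := by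
  apply coeff_eq_zero_of_totalDegree_lt_degree
  refine (totalDegree_mul _ _).trans_lt ?_
  have h1 := totalDegree_prod_pow_le l hl k
  have h2 : ((m + 1) • Finsupp.equivFunOnFinite.symm k + constExp ι m).degree =
      (∑ i, k i) * m + ∑ i, k i + Fintype.card ι * m := by
    rw [map_add, degree_constExp, map_nsmul, Finsupp.degree_eq_sum]
    simp only [Finsupp.coe_equivFunOnFinite_symm, smul_eq_mul]
    ring
  omega

/-- The residue functional of the system `X i ^ (m + 1) - l i` with `deg l i ≤ m`: it annihilates
the ideal of the system, and on polynomials of degree at most `card ι * m` it is the coefficient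
of `∏ X i ^ m`. -/
theorem exists_residue_functional {ι R : Type*} [Fintype ι] [DecidableEq ι] [CommRing R]
    {m : ℕ} (l : ι → MvPolynomial ι R) (hl : ∀ i, (l i).totalDegree ≤ m) :
    ∃ ρ : MvPolynomial ι R →ₗ[R] R,
      (∀ i g, ρ ((X i ^ (m + 1) - l i) * g) = 0) ∧
      ∀ g, g.totalDegree ≤ Fintype.card ι * m → ρ g = coeff (constExp ι m) g := by
  set T : MvPolynomial ι R → (ι → ℕ) → R := fun g k =>
    coeff ((m + 1) • Finsupp.equivFunOnFinite.symm k + constExp ι m) (g * ∏ i, l i ^ k i) with hT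
  have hfin : ∀ g, (Function.support (T g)).Finite := by
    intro g
    refine (Set.finite_Icc (0 : ι → ℕ) fun _ => g.totalDegree).subset fun k hk => ?_
    refine ⟨fun i => Nat.zero_le _, fun i => ?_⟩
    by_contra hi
    refine hk (coeff_mul_prod_pow_eq_zero l hl g k ?_)
    have := Finset.single_le_sum (f := k) (fun _ _ => Nat.zero_le _) (Finset.mem_univ i)
    simp only [not_le] at hi
    omega
  let ρ : MvPolynomial ι R →ₗ[R] R :=
    { toFun := fun g => ∑ᶠ k, T g k
      map_add' := fun g g' => by
        rw [← finsum_add_distrib (hfin g) (hfin g')]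
        simp [hT, add_mul]
      map_smul' := fun c g => by
        rw [RingHom.id_apply, smul_finsum' c (hfin g)]
        simp [hT] }
  refine ⟨ρ, fun i g => ?_, fun g hg => ?_⟩
  · rw [sub_mul, map_sub, sub_eq_zero]
    change ∑ᶠ k, T (X i ^ (m + 1) * g) k = ∑ᶠ k, T (l i * g) k
    have hinj : Function.Injective fun k : ι → ℕ => k + Pi.single i 1 :=
      add_left_injective _
    have hshift : ∀ k, T (l i * g) k = T (X i ^ (m + 1) * g) (k + Pi.single i 1) := by
      intro k
      have h1 : (m + 1) • Finsupp.equivFunOnFinite.symm (k + Pi.single i 1) + constExp ι m =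
          Finsupp.single i (m + 1) +
            ((m + 1) • Finsupp.equivFunOnFinite.symm k + constExp ι m) := by
        ext j
        by_cases hj : j = i
        · subst hj; simp; ring
        · simp [hj]
      have h2 : ∏ j, l j ^ (k + Pi.single i 1 : ι → ℕ) j = l i * ∏ j, l j ^ k j := by
        have h3 : ∀ j, l j ^ (Pi.single i 1 : ι → ℕ) j = if j = i then l j else 1 := fun j => by
          by_cases hj : j = i
          · subst hj; simp
          · simp [hj]
        simp only [Pi.add_apply, pow_add, Finset.prod_mul_distrib, h3]
        rw [Finset.prod_ite_eq' Finset.univ i l, if_pos (Finset.mem_univ _), mul_comm]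
      simp only [hT]
      rw [h1, h2, X_pow_eq_monomial, mul_assoc (monomial _ _), coeff_monomial_mul, one_mul]
      congr 1
      ring
    simp_rw [hshift]
    rw [← finsum_mem_range hinj]
    rw [← finsum_mem_univ]
    refine finsum_mem_inter_support_eq _ _ _ ?_
    rw [Set.univ_inter, eq_comm, Set.inter_eq_right]
    intro k hk
    refine ⟨k - Pi.single i 1, ?_⟩
    have hki : k i ≠ 0 := by
      intro h0
      apply hk
      simp only [hT]
      rw [X_pow_eq_monomial, mul_assoc, coeff_monomial_mul', if_neg]
      intro hle
      have := hle i
      simp [constExp, h0] at this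
    ext j
    by_cases hj : j = i
    · subst hj; simp; omega
    · simp [hj]
  · change ∑ᶠ k, T g k = _
    rw [finsum_eq_single _ 0]
    · have h0 : (Finsupp.equivFunOnFinite.symm (0 : ι → ℕ)) = (0 : ι →₀ ℕ) := by ext; simp
      simp [hT, h0]
    · intro k hk
      refine coeff_mul_prod_pow_eq_zero l hl g k ?_
      have : 0 < ∑ i, k i := by
        obtain ⟨i, hi⟩ := Function.ne_iff.1 hk
        exact Finset.sum_pos' (fun _ _ => Nat.zero_le _)
          ⟨i, Finset.mem_univ i, Nat.pos_of_ne_zero hi⟩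
      omega

theorem exists_monomial_sub_eval_eq {ι R : Type*} [Fintype ι] [DecidableEq ι] [CommRing R]
    (p : ι → R) (d : ℕ) : ∀ (s : ι →₀ ℕ) (c : R), s.degree = d →
    ∃ δ : ι → MvPolynomial ι R, (∀ j, (δ j).totalDegree ≤ d - 1) ∧
      monomial s c - C (eval p (monomial s c)) = ∑ j, δ j * (X j - C (p j)) := by
  induction d with
  | zero =>
    intro s c hs
    rw [Finsupp.degree_eq_zero_iff] at hs
    subst hs
    exact ⟨0, by simp, by simp [← C_apply]⟩
  | succ d ih =>
    intro s c hs
    have hs0 : s ≠ 0 := by rintro rfl; simp at hs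
    obtain ⟨i, hi⟩ := Finsupp.ne_iff.1 hs0
    obtain ⟨t, rfl⟩ : ∃ t, s = t + Finsupp.single i 1 :=
      ⟨s - Finsupp.single i 1, (tsub_add_cancel_of_le
        (Finsupp.single_le_iff.2 (Nat.pos_of_ne_zero hi))).symm⟩
    have ht : t.degree = d := by simpa using hs
    obtain ⟨δ, hδ, h⟩ := ih t c ht
    have hmon : monomial (t + Finsupp.single i 1) c = monomial t c * X i := by
      simp [X, monomial_mul]
    refine ⟨fun j => C (p i) * δ j + Pi.single (M := fun _ => MvPolynomial ι R) i (monomial t c) j,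
      fun j => ?_, ?_⟩
    · refine (totalDegree_add _ _).trans (max_le ?_ ?_)
      · refine (totalDegree_mul _ _).trans ?_
        have := hδ j
        rw [totalDegree_C]
        omega
      · by_cases hj : j = i
        · subst hj
          rw [Pi.single_eq_same]
          refine (totalDegree_monomial_le t c).trans ?_
          change t.degree ≤ _
          omega
        · simp [hj]
    · have hsum : ∑ j, (C (p i) * δ j + Pi.single (M := fun _ => MvPolynomial ι R) i
          (monomial t c) j) * (X j - C (p j)) =
          C (p i) * (∑ j, δ j * (X j - C (p j))) + monomial t c * (X i - C (p i)) := by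
        simp [add_mul, Finset.sum_add_distrib, Finset.mul_sum, mul_assoc, Pi.single_apply]
      rw [hsum, ← h, hmon, map_mul (eval p), eval_X, map_mul C]
      ring

theorem exists_sub_eval_eq {ι R : Type*} [Fintype ι] [DecidableEq ι] [CommRing R]
    (p : ι → R) (g : MvPolynomial ι R) :
    ∃ δ : ι → MvPolynomial ι R, (∀ j, (δ j).totalDegree ≤ g.totalDegree - 1) ∧
      g - C (eval p g) = ∑ j, δ j * (X j - C (p j)) := by
  choose δ hδ h using fun s c => exists_monomial_sub_eval_eq p (Finsupp.degree s) s c rfl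
  refine ⟨fun j => ∑ s ∈ g.support, δ s (coeff s g) j, fun j => ?_, ?_⟩
  · refine totalDegree_finsetSum_le fun s hs => (hδ _ _ _).trans ?_
    exact Nat.sub_le_sub_right (le_totalDegree hs) 1
  · simp_rw [Finset.sum_mul]
    rw [Finset.sum_comm]
    simp_rw [← h]
    rw [Finset.sum_sub_distrib, ← map_sum C, ← map_sum (eval p), support_sum_monomial_coeff]

theorem eval_pderiv_eq_of_sub_eq {ι R : Type*} [Fintype ι] [DecidableEq ι] [CommRing R]
    {p : ι → R} {g : MvPolynomial ι R} {c : R} {δ : ι → MvPolynomial ι R}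
    (h : g - C c = ∑ j, δ j * (X j - C (p j))) (j : ι) :
    eval p (pderiv j g) = eval p (δ j) := by
  have h1 : pderiv j g = pderiv j (∑ j, δ j * (X j - C (p j))) := by
    rw [← h]; simp
  rw [h1]
  simp [Derivation.leibniz, pderiv_X, Pi.single_apply, apply_ite (eval p)]

theorem homogeneousComponent_mul_of_isHomogeneous {σ R : Type*} [CommRing R]
    (b : MvPolynomial σ R) {φ : MvPolynomial σ R} {d : ℕ} (hφ : φ.IsHomogeneous d) (k : ℕ) :
    homogeneousComponent (k + d) (b * φ) = homogeneousComponent k b * φ := by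
  conv_lhs => rw [← sum_homogeneousComponent b, Finset.sum_mul, map_sum]
  have h : ∀ i, homogeneousComponent (k + d) (homogeneousComponent i b * φ) =
      if i = k then homogeneousComponent k b * φ else 0 := fun i => by
    rw [homogeneousComponent_of_mem ((homogeneousComponent_isHomogeneous i b).mul hφ)]
    by_cases hi : i = k
    · simp [hi]
    · simp [hi, Ne.symm hi]
  simp_rw [h]
  rw [Finset.sum_ite_eq']
  split_ifs with hk
  · rfl
  · rw [homogeneousComponent_eq_zero, zero_mul]
    simpa [Nat.lt_succ_iff] using hk

theorem exists_X_pow_eq_sum_mul {ι K : Type*} [Fintype ι] [Field K] [IsAlgClosed K]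
    {e : ℕ} (F : ι → MvPolynomial ι K) (hF : ∀ i, (F i).IsHomogeneous (e + 1))
    (hzero : ∀ p : ι → K, (∀ i, eval p (F i) = 0) → p = 0) :
    ∃ (m : ℕ) (a : Matrix ι ι (MvPolynomial ι K)), e ≤ m ∧
      (∀ i j, (a i j).totalDegree ≤ m - e) ∧ ∀ i, X i ^ (m + 1) = ∑ j, a i j * F j := by
  have hrad : ∀ i, ∃ N, (X i : MvPolynomial ι K) ^ N ∈ Ideal.span (Set.range F) := by
    intro i
    rw [← Ideal.mem_radical_iff, ← vanishingIdeal_zeroLocus_eq_radical (K := K),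
      mem_vanishingIdeal_iff]
    intro p hp
    have : p = 0 := hzero p fun j => by
      simpa [aeval_eq_eval] using hp (F j) (Ideal.subset_span ⟨j, rfl⟩)
    simp [this]
  choose N hN using hrad
  have hm : ∀ i, ∃ b : ι → MvPolynomial ι K,
      ∑ j, b j * F j = X i ^ (∑ l, N l + (e + 1)) := by
    intro i
    refine Ideal.mem_span_range_iff_exists_fun.1 (Ideal.pow_mem_of_pow_mem _ (hN i) ?_)
    have := Finset.single_le_sum (f := N) (fun _ _ => Nat.zero_le _) (Finset.mem_univ i)
    omega
  choose b hb using hm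
  refine ⟨∑ l, N l + e, fun i j => homogeneousComponent (∑ l, N l) (b i j), by omega,
    fun i j => ?_, fun i => ?_⟩
  · rw [Nat.add_sub_cancel]
    exact (homogeneousComponent_isHomogeneous _ _).totalDegree_le
  · have h := congrArg (homogeneousComponent (∑ l, N l + (e + 1))) (hb i)
    rw [map_sum, homogeneousComponent_eq_self (isHomogeneous_X_pow i _)] at h
    change X i ^ (∑ l, N l + (e + 1)) = _
    rw [← h]
    exact Finset.sum_congr rfl fun j _ => homogeneousComponent_mul_of_isHomogeneous _ (hF j) _

theorem det_mul_mem_of_mulVec_mem {ι A : Type*} [Fintype ι] [DecidableEq ι] [CommRing A]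
    (I : Ideal A) (N : Matrix ι ι A) (v : ι → A) (h : ∀ i, ∑ l, N i l * v l ∈ I) (j : ι) :
    N.det * v j ∈ I := by
  have key : N.det * v j = ∑ i, N.adjugate j i * ∑ l, N i l * v l := by
    have h := congrArg (fun B => Matrix.mulVec B v j) (Matrix.adjugate_mul N)
    simp only [← Matrix.mulVec_mulVec, Matrix.smul_mulVec, Matrix.one_mulVec] at h
    simp only [Matrix.mulVec, dotProduct, Pi.smul_apply, smul_eq_mul] at h
    exact h.symm
  rw [key]
  exact I.sum_mem fun i _ => I.mul_mem_left _ (h i)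

/-- If every common zero of a square polynomial system is simple, then every polynomial vanishing
at all the common zeros lies in the ideal of the system. -/
theorem mem_span_of_forall_eval_eq_zero {ι K : Type*} [Fintype ι] [DecidableEq ι] [Field K]
    [IsAlgClosed K] (f : ι → MvPolynomial ι K)
    (hsimple : ∀ p : ι → K, (∀ i, eval p (f i) = 0) →
      Matrix.det (Matrix.of fun i j => eval p (pderiv j (f i))) ≠ 0)
    {G : MvPolynomial ι K} (hG : ∀ p : ι → K, (∀ i, eval p (f i) = 0) → eval p G = 0) :
    G ∈ Ideal.span (Set.range f) := by
  set I := Ideal.span (Set.range f) with hI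
  have hfI : ∀ i, f i ∈ I := fun i => Ideal.subset_span ⟨i, rfl⟩
  by_contra hGI
  set Q : Ideal (MvPolynomial ι K) := I.colon {G} with hQ
  have hmemQ : ∀ {q}, q ∈ Q ↔ q * G ∈ I := by
    intro q
    rw [hQ, Submodule.mem_colon_singleton, smul_eq_mul]
  have hQtop : Q ≠ ⊤ := by
    rw [Ne, Ideal.eq_top_iff_one, hmemQ, one_mul]
    exact hGI
  obtain ⟨P, hP, hQP⟩ := Ideal.exists_le_maximal Q hQtop
  obtain ⟨p, rfl⟩ := (isMaximal_iff_eq_vanishingIdeal_singleton (K := K)).1 hP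
  have hmem : ∀ {q}, q ∈ Q → eval p q = 0 := by
    intro q hq
    simpa [mem_vanishingIdeal_singleton_iff, aeval_eq_eval] using hQP hq
  have hp : ∀ i, eval p (f i) = 0 := fun i => hmem (hmemQ.2 (I.mul_mem_right _ (hfI i)))
  choose δ _ hδ using fun i => exists_sub_eval_eq p (f i)
  refine hsimple p hp ?_
  have hdet : eval p (Matrix.det (Matrix.of δ)) =
      Matrix.det (Matrix.of fun i j => eval p (pderiv j (f i))) := by
    rw [RingHom.map_det]
    congr 1
    ext i j
    simp [eval_pderiv_eq_of_sub_eq (hδ i) j]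
  rw [← hdet]
  refine hmem (hmemQ.2 ?_)
  have hX : ∀ j, (Matrix.of δ).det * (X j - C (p j)) ∈ I := by
    refine det_mul_mem_of_mulVec_mem I (Matrix.of δ) (fun j => X j - C (p j)) fun i => ?_
    simp only [Matrix.of_apply]
    rw [← hδ i, hp i, C_0, sub_zero]
    exact hfI i
  obtain ⟨γ, _, hγ⟩ := exists_sub_eval_eq p G
  rw [hG p hp, C_0, sub_zero] at hγ
  rw [hγ, Finset.mul_sum]
  refine I.sum_mem fun j _ => ?_
  rw [mul_left_comm]
  exact I.mul_mem_left _ (hX j)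

/-- The Euler–Jacobi vanishing theorem: if the leading forms `F i`, of degree `e + 1`, of a square
system `F i - l i` have no common zero but the origin and all common zeros of the system are
simple, then `∑ g / J` over the common zeros vanishes as soon as `deg g` is less than the degree
of the Jacobian determinant `J`. -/
theorem sum_eval_div_det_eq_zero {ι K : Type*} [Fintype ι] [DecidableEq ι] [Field K]
    [IsAlgClosed K] {e : ℕ} (F l : ι → MvPolynomial ι K)
    (hF : ∀ i, (F i).IsHomogeneous (e + 1)) (hl : ∀ i, (l i).totalDegree ≤ e)
    (hzero : ∀ p : ι → K, (∀ i, eval p (F i) = 0) → p = 0)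
    (T : Finset (ι → K)) (hT : ∀ p, p ∈ T ↔ ∀ i, eval p (F i - l i) = 0)
    (hsimple : ∀ p ∈ T, Matrix.det (Matrix.of fun i j => eval p (pderiv j (F i - l i))) ≠ 0)
    (g : MvPolynomial ι K) (hg : g.totalDegree < Fintype.card ι * e) :
    ∑ p ∈ T, eval p g / Matrix.det (Matrix.of fun i j => eval p (pderiv j (F i - l i))) = 0 := by
  obtain ⟨m, a, hem, ha, haX⟩ := exists_X_pow_eq_sum_mul F hF hzero
  set f : ι → MvPolynomial ι K := fun i => F i - l i with hf
  set J : (ι → K) → K := fun p => Matrix.det (Matrix.of fun i j => eval p (pderiv j (f i)))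
    with hJ
  have hfdeg : ∀ i, (f i).totalDegree ≤ e + 1 := fun i =>
    (totalDegree_sub _ _).trans (max_le (hF i).totalDegree_le ((hl i).trans (Nat.le_succ e)))
  have hlow : ∀ i, (∑ j, a i j * l j).totalDegree ≤ m := fun i =>
    totalDegree_finsetSum_le fun j _ => (totalDegree_mul _ _).trans (by
      have := ha i j
      have := hl j
      omega)
  have haf : ∀ i, ∑ j, a i j * f j = X i ^ (m + 1) - ∑ j, a i j * l j := fun i => by
    simp [hf, mul_sub, haX i]
  obtain ⟨ρ, hρ, hρcoeff⟩ := exists_residue_functional (fun i => ∑ j, a i j * l j) hlow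
  have hdeta : a.det.totalDegree ≤ Fintype.card ι * (m - e) := by
    simpa using totalDegree_det_le a (fun _ => m - e) ha
  have hρI : ∀ q ∈ Ideal.span (Set.range f), ρ (a.det * q) = 0 := by
    have hker : ∀ q ∈ Ideal.span (Set.range fun i => X i ^ (m + 1) - ∑ j, a i j * l j),
        ρ q = 0 := by
      intro q hq
      obtain ⟨c, rfl⟩ := Ideal.mem_span_range_iff_exists_fun.1 hq
      rw [map_sum]
      exact Finset.sum_eq_zero fun i _ => by rw [mul_comm]; exact hρ i _
    intro q hq
    obtain ⟨c, rfl⟩ := Ideal.mem_span_range_iff_exists_fun.1 hq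
    refine hker _ ?_
    rw [Finset.mul_sum]
    refine Ideal.sum_mem _ fun j _ => ?_
    rw [mul_left_comm]
    refine Ideal.mul_mem_left _ _ (det_mul_mem_of_mulVec_mem _ a f (fun i => ?_) j)
    rw [haf]
    exact Ideal.subset_span ⟨i, rfl⟩
  choose δ hδdeg hδ using fun (p : ι → K) i => exists_sub_eval_eq p (f i)
  have hδf : ∀ p ∈ T, ∀ i, f i = ∑ j, δ p i j * (X j - C (p j)) := by
    intro p hp i
    rw [← hδ, (hT p).1 hp i, C_0, sub_zero]
  have hδdeg' : ∀ p i j, (δ p i j).totalDegree ≤ e := fun p i j =>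
    (hδdeg p i j).trans (by have := hfdeg i; omega)
  have hdiag : ∀ p, eval p (Matrix.of (δ p)).det = J p := by
    intro p
    rw [RingHom.map_det]
    congr 1
    ext i j
    simp [eval_pderiv_eq_of_sub_eq (hδ p i) j]
  have hoff : ∀ p ∈ T, ∀ q ∈ T, q ≠ p → eval q (Matrix.of (δ p)).det = 0 := by
    intro p hp q hq hqp
    rw [RingHom.map_det]
    refine Matrix.exists_mulVec_eq_zero_iff.1 ⟨q - p, sub_ne_zero.2 hqp, ?_⟩
    ext i
    have h := congrArg (eval q) (hδf p hp i)
    rw [(hT q).1 hq i] at h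
    simpa [Matrix.mulVec, dotProduct] using h.symm
  have hρδ : ∀ p ∈ T, ρ (a.det * (Matrix.of (δ p)).det) = 1 := by
    intro p hp
    rw [← Matrix.det_mul]
    have hEdeg : ∀ i j, ((a * Matrix.of (δ p)) i j).totalDegree ≤ m := by
      intro i j
      rw [Matrix.mul_apply]
      refine totalDegree_finsetSum_le fun k _ => (totalDegree_mul _ _).trans ?_
      have := ha i k
      have := hδdeg' p k j
      simp only [Matrix.of_apply]
      omega
    rw [hρcoeff _ (by simpa using totalDegree_det_le _ (fun _ => m) hEdeg)]
    refine coeff_constExp_det_eq_one _ hEdeg fun i => ?_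
    have hE : ∑ k, (a * Matrix.of (δ p)) i k * X k - X i ^ (m + 1) =
        ∑ k, (a * Matrix.of (δ p)) i k * C (p k) - ∑ j, a i j * l j := by
      have h1 : ∑ k, (a * Matrix.of (δ p)) i k * (X k - C (p k)) = ∑ j, a i j * f j := by
        simp_rw [Matrix.mul_apply, Finset.sum_mul, Matrix.of_apply]
        rw [Finset.sum_comm]
        refine Finset.sum_congr rfl fun j _ => ?_
        rw [hδf p hp j, Finset.mul_sum]
        exact Finset.sum_congr rfl fun k _ => mul_assoc _ _ _
      simp_rw [mul_sub, Finset.sum_sub_distrib] at h1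
      rw [haf] at h1
      linear_combination h1
    rw [hE]
    refine (totalDegree_sub _ _).trans (max_le ?_ (hlow i))
    refine totalDegree_finsetSum_le fun k _ => (totalDegree_mul _ _).trans ?_
    rw [totalDegree_C]
    exact hEdeg i k
  have hmem : g - ∑ p ∈ T, C (eval p g / J p) * (Matrix.of (δ p)).det ∈
      Ideal.span (Set.range f) := by
    refine mem_span_of_forall_eval_eq_zero f (fun p hp => hsimple p ((hT p).2 hp)) fun q hq => ?_
    have hqT := (hT q).2 hq
    rw [map_sub, map_sum, Finset.sum_eq_single_of_mem q hqT]
    · rw [map_mul, eval_C, hdiag, div_mul_cancel₀ _ (hsimple q hqT), sub_self]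
    · intro p hp hpq
      rw [map_mul, hoff p hp q hqT hpq.symm, mul_zero]
  have h0 := hρI _ hmem
  rw [mul_sub, map_sub, Finset.mul_sum, map_sum] at h0
  have hterm : ∀ p ∈ T, ρ (a.det * (C (eval p g / J p) * (Matrix.of (δ p)).det)) =
      eval p g / J p := by
    intro p hp
    rw [mul_left_comm, ← smul_eq_C_mul, map_smul, hρδ p hp, smul_eq_mul, mul_one]
  rw [Finset.sum_congr rfl hterm] at h0
  have hgdeg : (a.det * g).totalDegree < Fintype.card ι * m := by
    refine (totalDegree_mul _ _).trans_lt ?_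
    have : Fintype.card ι * m = Fintype.card ι * (m - e) + Fintype.card ι * e := by
      rw [← mul_add, Nat.sub_add_cancel hem]
    omega
  rw [hρcoeff _ hgdeg.le, coeff_eq_zero_of_totalDegree_lt_degree
    (by rwa [degree_constExp]), zero_sub, neg_eq_zero] at h0
  exact h0

theorem esymm_card_eq_prod {R : Type*} [CommRing R] (s : Multiset R) :
    s.esymm (Multiset.card s) = s.prod := by
  simp [Multiset.esymm, Multiset.powersetCard_self]

theorem esymm_cons_succ {R : Type*} [CommRing R] (a : R) (s : Multiset R) (r : ℕ) :
    (a ::ₘ s).esymm (r + 1) = s.esymm (r + 1) + a * s.esymm r := by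
  simp [Multiset.esymm, Multiset.powersetCard_cons, Multiset.sum_map_mul_left]

theorem esymm_eq_sum_esymm_cons {R : Type*} [CommRing R] (a : R) (s : Multiset R) (r : ℕ) :
    s.esymm r = ∑ j ∈ Finset.range (r + 1), (-a) ^ (r - j) * (a ::ₘ s).esymm j := by
  induction r with
  | zero => simp [Multiset.esymm]
  | succ r ih =>
    have h : ∀ j ∈ Finset.range (r + 1), (-a) ^ (r + 1 - j) * (a ::ₘ s).esymm j =
        -a * ((-a) ^ (r - j) * (a ::ₘ s).esymm j) := fun j hj => by
      rw [Nat.succ_sub (Nat.lt_succ_iff.1 (Finset.mem_range.1 hj)), pow_succ']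
      ring
    rw [Finset.sum_range_succ, Finset.sum_congr rfl h, ← Finset.mul_sum, ← ih, esymm_cons_succ]
    simp

theorem esymm_roots_charpoly {ι K : Type*} [Fintype ι] [DecidableEq ι] [Field K] [IsAlgClosed K]
    (A : Matrix ι ι K) {j : ℕ} (hj : j ≤ Fintype.card ι) :
    A.charpoly.roots.esymm j = (-1) ^ j * A.charpoly.coeff (Fintype.card ι - j) := by
  have h := Polynomial.coeff_eq_esymm_roots_of_splits (IsAlgClosed.splits A.charpoly)
    (k := Fintype.card ι - j) (by rw [Matrix.charpoly_natDegree_eq_dim]; omega)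
  rw [Matrix.charpoly_natDegree_eq_dim, (Matrix.charpoly_monic A).leadingCoeff, one_mul,
    Nat.sub_sub_self hj] at h
  rw [h, ← mul_assoc, ← mul_pow]
  simp

theorem totalDegree_charpoly_coeff_le {ι σ R : Type*} [Fintype ι] [DecidableEq ι] [CommRing R]
    {e : ℕ} (P : Matrix ι ι (MvPolynomial σ R)) (hP : ∀ i j, (P i j).totalDegree ≤ e)
    {i j : ℕ} (hij : i + j = Fintype.card ι) :
    (P.charpoly.coeff i).totalDegree ≤ j * e := by
  have h := Matrix.charpoly.univ_coeff_eval₂Hom ι (C : R →+* MvPolynomial σ R)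
    (Function.uncurry P) i
  have hcurry : Matrix.of (Function.curry (Function.uncurry P)) = P := rfl
  rw [hcurry] at h
  rw [← h, coe_eval₂Hom, eval₂_eq]
  refine totalDegree_finsetSum_le fun s hs => ?_
  have hs' := (Matrix.charpoly.univ_coeff_isHomogeneous R ι i j hij).degree_eq_sum_deg_support hs
  refine (totalDegree_mul _ _).trans ?_
  rw [totalDegree_C, zero_add, hs', Finset.sum_mul]
  exact (totalDegree_finsetProd _ _).trans (Finset.sum_le_sum fun x _ =>
    (totalDegree_pow _ _).trans (Nat.mul_le_mul_left _ (hP x.1 x.2)))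

theorem charpoly_neg_one_coeff {ι R : Type*} [Fintype ι] [DecidableEq ι] [CommRing R] (i : ℕ) :
    (-1 : Matrix ι ι R).charpoly.coeff i = (Fintype.card ι).choose i := by
  have h : (-1 : Matrix ι ι R) = Matrix.diagonal fun _ => -1 := by
    rw [← Matrix.diagonal_one, Matrix.diagonal_neg]
  rw [h, Matrix.charpoly_diagonal]
  simp [Polynomial.coeff_X_add_one_pow]

theorem eval_zero_of_isHomogeneous {σ R : Type*} [CommRing R] {φ : MvPolynomial σ R} {d : ℕ}
    (hφ : φ.IsHomogeneous d) (hd : d ≠ 0) : eval 0 φ = 0 := by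
  rw [eval_zero, constantCoeff_eq]
  exact hφ.coeff_eq_zero (by simpa using hd.symm)

theorem sum_choose_mul_pow_eq {R : Type*} [CommRing R] (a : R) (n : ℕ) :
    ∀ r < n, ∑ j ∈ Finset.range (r + 1), (n.choose j : R) * a ^ (r - j) =
      ∑ i ∈ Finset.range (r + 1), ((n - 1 - i).choose (r - i) : R) * (a + 1) ^ i := by
  have hrec : ∀ n r : ℕ, ∑ j ∈ Finset.range (r + 2), (n.choose j : R) * a ^ (r + 1 - j) =
      a * ∑ j ∈ Finset.range (r + 1), (n.choose j : R) * a ^ (r - j) + n.choose (r + 1) := by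
    intro n r
    rw [Finset.sum_range_succ, Finset.mul_sum]
    congr 1
    · refine Finset.sum_congr rfl fun j hj => ?_
      rw [Nat.succ_sub (Nat.lt_succ_iff.1 (Finset.mem_range.1 hj)), pow_succ]
      ring
    · simp
  induction n with
  | zero => intro r hr; omega
  | succ n ih =>
    intro r hr
    cases r with
    | zero => simp
    | succ r =>
      have hpascal : ∑ j ∈ Finset.range (r + 2), ((n + 1).choose j : R) * a ^ (r + 1 - j) =
          ∑ j ∈ Finset.range (r + 2), (n.choose j : R) * a ^ (r + 1 - j) +
            ∑ j ∈ Finset.range (r + 1), (n.choose j : R) * a ^ (r - j) := by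
        rw [Finset.sum_range_succ' _ (r + 1), Finset.sum_range_succ' _ (r + 1)]
        simp [Nat.choose_succ_succ, add_mul, Finset.sum_add_distrib]
        ring
      rw [hpascal, hrec, ih r (by omega), Finset.sum_range_succ' _ (r + 1)]
      have hshift : ∀ i, ((n + 1 - 1 - (i + 1)).choose (r + 1 - (i + 1)) : R) * (a + 1) ^ (i + 1) =
          (a + 1) * (((n - 1 - i).choose (r - i) : R) * (a + 1) ^ i) := fun i => by
        rw [show n + 1 - 1 - (i + 1) = n - 1 - i by omega, show r + 1 - (i + 1) = r - i by omega,
          pow_succ]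
        ring
      simp_rw [hshift, ← Finset.mul_sum]
      simp
      ring

/-- Universal relations among the Darboux-point eigenvalues of a generic homogeneous force
`F` (components homogeneous of degree `k−1`, not necessarily potential), all of whose
Darboux points are proper and simple: for `r = 0,…,n−1`,
`Σ_{d∈S} τ₁(Λ(d))^r / τ_{n−1}(Λ(d)) = (k−2)·(−1)^{n−1+r}·(n+k−2)^r` and
`Σ_{d∈S} τ_r(Λ(d)) / τ_{n−1}(Λ(d)) = (k−2)·(−1)^{r+1−n}·Σ_{i=0}^{r} C(n−i−1,r−i)(k−1)^i`,
where `S = {d ≠ 0 : F(d) = d}` is the set of normalized Darboux points. -/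
theorem stmt12 {n k : ℕ} (hn : 2 ≤ n) (hk : 2 < k)
    (F : Fin n → MvPolynomial (Fin n) ℂ)
    (hF : ∀ i, (F i).IsHomogeneous (k - 1))
    -- (i) every Darboux point is proper
    (hproper : ∀ d : Fin n → ℂ, d ≠ 0 →
      (∀ i j, d i * forceEval F d j = d j * forceEval F d i) → forceEval F d ≠ 0)
    (S : Set (Fin n → ℂ)) (hSdef : S = {d | d ≠ 0 ∧ forceEval F d = d})
    (hfin : S.Finite)
    -- (ii) every Darboux point is simple
    (hsimple : ∀ d ∈ S, Matrix.det (forceJac F d - 1) ≠ 0) :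
    ∀ r < n,
      (∑ d ∈ hfin.toFinset,
          (shiftedSpectrumF k F d).sum ^ r / (shiftedSpectrumF k F d).esymm (n - 1) =
        ((k : ℂ) - 2) * (-1) ^ (n - 1 + r) * ((n : ℂ) + (k : ℂ) - 2) ^ r) ∧
      (∑ d ∈ hfin.toFinset,
          (shiftedSpectrumF k F d).esymm r / (shiftedSpectrumF k F d).esymm (n - 1) =
        ((k : ℂ) - 2) * (-1 : ℂ) ^ (r + 1 - n : ℤ) *
          ∑ i ∈ Finset.range (r + 1),
            (Nat.choose (n - i - 1) (r - i) : ℂ) * ((k : ℂ) - 1) ^ i) := by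
  classical
  obtain ⟨e, rfl⟩ : ∃ e, k = e + 2 := ⟨k - 2, by omega⟩
  have he : 0 < e := by omega
  have hk2 : ((e + 2 : ℕ) : ℂ) - 2 = e := by push_cast; ring
  have heC : (e : ℂ) ≠ 0 := by exact_mod_cast he.ne'
  replace hF : ∀ i, (F i).IsHomogeneous (e + 1) := hF
  have heval0 : ∀ i, eval 0 (F i) = 0 := fun i => eval_zero_of_isHomogeneous (hF i) e.succ_ne_zero
  have hJac : ∀ d, Matrix.of (fun i j => eval d (pderiv j (F i - X i))) = forceJac F d - 1 := by
    intro d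
    ext i j
    simp [forceJac, pderiv_X, Matrix.one_apply, Pi.single_apply, apply_ite (eval d)]
  have hJac0 : forceJac F 0 - 1 = -1 := by
    have : forceJac F 0 = 0 := by
      ext i j
      exact eval_zero_of_isHomogeneous (hF i).pderiv he.ne'
    rw [this, zero_sub]
  have hdet0 : (forceJac F 0 - 1).det = (-1) ^ n := by
    rw [hJac0, Matrix.det_neg, Matrix.det_one, Fintype.card_fin, mul_one]
  have hmemS : ∀ d, d ∈ hfin.toFinset ↔ d ≠ 0 ∧ forceEval F d = d := fun d => by
    rw [Set.Finite.mem_toFinset, hSdef, Set.mem_ofPred_eq]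
  have h0S : (0 : Fin n → ℂ) ∉ hfin.toFinset := fun h => ((hmemS 0).1 h).1 rfl
  have hsum : ∀ g : MvPolynomial (Fin n) ℂ, g.totalDegree < n * e →
      ∑ d ∈ hfin.toFinset, eval d g / (forceJac F d - 1).det = -(eval 0 g / (-1) ^ n) := by
    intro g hg
    have h := sum_eval_div_det_eq_zero (e := e) F X hF
      (fun i => (totalDegree_X i).trans_le he)
      (fun p hp => by
        by_contra hp0
        have hFp : forceEval F p = 0 := funext hp
        exact hproper p hp0 (by simp [hFp]) hFp)
      (insert 0 hfin.toFinset)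
      (fun p => by
        rw [Finset.mem_insert, hmemS]
        constructor
        · rintro (rfl | ⟨_, hp⟩) i
          · rw [map_sub, heval0, eval_X, Pi.zero_apply, sub_zero]
          · rw [map_sub, eval_X, sub_eq_zero]
            exact congrFun hp i
        · intro hp
          by_cases hp0 : p = 0
          · exact Or.inl hp0
          · refine Or.inr ⟨hp0, funext fun i => ?_⟩
            simpa [sub_eq_zero, forceEval] using hp i)
      (fun p hp => by
        rw [hJac]
        rcases Finset.mem_insert.1 hp with rfl | hp
        · rw [hdet0]
          exact pow_ne_zero _ (by norm_num)
        · exact hsimple p (hfin.mem_toFinset.1 hp))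
      g (by rwa [Fintype.card_fin])
    simp only [hJac] at h
    rw [Finset.sum_insert h0S, hdet0] at h
    linear_combination h
  set P : Matrix (Fin n) (Fin n) (MvPolynomial (Fin n) ℂ) :=
    Matrix.of fun i j => pderiv j (F i - X i) with hP
  have hPdeg : ∀ i j, (P i j).totalDegree ≤ e := by
    intro i j
    rw [hP, Matrix.of_apply, map_sub, pderiv_X]
    refine (totalDegree_sub _ _).trans (max_le (hF i).pderiv.totalDegree_le ?_)
    rw [Pi.single_apply]
    split_ifs <;> simp
  have hPeval : ∀ d, (eval d).mapMatrix P = forceJac F d - 1 := fun d => by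
    rw [← hJac]
    rfl
  have hPcoeff : ∀ d i, eval d (P.charpoly.coeff i) = (forceJac F d - 1).charpoly.coeff i := by
    intro d i
    rw [← hPeval, RingHom.mapMatrix_apply, Matrix.charpoly_map, Polynomial.coeff_map]
  have hPtrace : ∀ d, eval d P.trace = (forceJac F d - 1).trace := by
    intro d
    rw [← hPeval, RingHom.mapMatrix_apply, ← AddMonoidHom.map_trace]
  have hroots : ∀ d ∈ hfin.toFinset,
      (forceJac F d - 1).charpoly.roots = (e : ℂ) ::ₘ shiftedSpectrumF (e + 2) F d := by
    intro d hd
    obtain ⟨hd0, hFd⟩ := (hmemS d).1 hd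
    rw [shiftedSpectrumF, hk2, Multiset.cons_erase]
    rw [Polynomial.mem_roots (Matrix.charpoly_monic _).ne_zero, Polynomial.IsRoot.def,
      Matrix.eval_charpoly]
    refine Matrix.exists_mulVec_eq_zero_iff.1 ⟨d, hd0, ?_⟩
    have hE : Matrix.mulVec (forceJac F d) d = ((e : ℂ) + 1) • d := by
      ext i
      have h := congrArg (eval d) (hF i).sum_X_mul_pderiv
      have h2 : eval d (F i) = d i := congrFun hFd i
      simp only [map_sum, map_mul, eval_X, nsmul_eq_mul, map_natCast, h2] at h
      simp only [Matrix.mulVec, dotProduct, forceJac, Matrix.of_apply, Pi.smul_apply, smul_eq_mul]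
      rw [Finset.sum_congr rfl fun j _ => mul_comm _ _, h]
      push_cast
      ring
    ext i
    rw [Matrix.sub_mulVec, Matrix.sub_mulVec, hE]
    simp [add_mul]
  have htop : ∀ d ∈ hfin.toFinset,
      (shiftedSpectrumF (e + 2) F d).esymm (n - 1) = (forceJac F d - 1).det / e := by
    intro d hd
    have hcard : Multiset.card (shiftedSpectrumF (e + 2) F d) = n - 1 := by
      have h := congrArg Multiset.card (hroots d hd)
      rw [IsAlgClosed.card_roots_eq_natDegree, Matrix.charpoly_natDegree_eq_dim, Fintype.card_fin,
        Multiset.card_cons] at h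
      omega
    rw [Matrix.det_eq_prod_roots_charpoly, hroots d hd, Multiset.prod_cons,
      mul_div_cancel_left₀ _ heC, ← hcard]
    exact esymm_card_eq_prod _
  have hconclude : ∀ (g : MvPolynomial (Fin n) ℂ) (φ : (Fin n → ℂ) → ℂ),
      g.totalDegree < n * e → (∀ d ∈ hfin.toFinset, φ d = eval d g) →
      ∑ d ∈ hfin.toFinset, φ d / (shiftedSpectrumF (e + 2) F d).esymm (n - 1) =
        -(e * eval 0 g / (-1) ^ n) := by
    intro g φ hg hφ
    rw [mul_div_assoc, ← mul_neg, ← hsum g hg, Finset.mul_sum]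
    refine Finset.sum_congr rfl fun d hd => ?_
    rw [htop d hd, hφ d hd, div_div_eq_mul_div]
    ring
  have hsq : ((-1 : ℂ) ^ n) * (-1) ^ n = 1 := by rw [← mul_pow]; norm_num
  intro r hr
  have hre : r * e < n * e := Nat.mul_lt_mul_of_pos_right hr he
  rw [hk2]
  constructor
  · rw [hconclude ((P.trace - C (e : ℂ)) ^ r) (fun d => (shiftedSpectrumF (e + 2) F d).sum ^ r)]
    · rw [map_pow, map_sub, hPtrace, hJac0, eval_C, Matrix.trace_neg, Matrix.trace_one,
        Fintype.card_fin]
      have h1 : (-(n : ℂ) - e) = (-1) * (n + ((e + 2 : ℕ) : ℂ) - 2) := by push_cast; ring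
      obtain ⟨n, rfl⟩ : ∃ n', n = n' + 1 := ⟨n - 1, by omega⟩
      rw [h1, mul_pow, Nat.add_sub_cancel, div_eq_mul_inv,
        inv_eq_of_mul_eq_one_left hsq, pow_add, pow_succ]
      ring
    · refine lt_of_le_of_lt ((totalDegree_pow _ _).trans (Nat.mul_le_mul_left r ?_)) hre
      refine (totalDegree_sub _ _).trans (max_le ?_ (by rw [totalDegree_C]; exact e.zero_le))
      exact totalDegree_finsetSum_le fun i _ => hPdeg i i
    · intro d hd
      have h := Matrix.trace_eq_sum_roots_charpoly (forceJac F d - 1)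
      rw [hroots d hd, Multiset.sum_cons] at h
      rw [map_pow, map_sub, hPtrace, eval_C, h, add_sub_cancel_left]
  · rw [hconclude (∑ j ∈ Finset.range (r + 1),
        C ((-(e : ℂ)) ^ (r - j) * (-1) ^ j) * P.charpoly.coeff (n - j))
        (fun d => (shiftedSpectrumF (e + 2) F d).esymm r)]
    · have h0 : eval 0 (∑ j ∈ Finset.range (r + 1),
          C ((-(e : ℂ)) ^ (r - j) * (-1) ^ j) * P.charpoly.coeff (n - j)) =
          (-1) ^ r * ∑ i ∈ Finset.range (r + 1),
            (Nat.choose (n - 1 - i) (r - i) : ℂ) * ((e : ℂ) + 1) ^ i := by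
        rw [← sum_choose_mul_pow_eq (e : ℂ) n r hr, map_sum, Finset.mul_sum]
        refine Finset.sum_congr rfl fun j hj => ?_
        have hjr : j ≤ r := Nat.lt_succ_iff.1 (Finset.mem_range.1 hj)
        rw [map_mul, eval_C, hPcoeff, hJac0, charpoly_neg_one_coeff, Fintype.card_fin,
          Nat.choose_symm (hjr.trans hr.le), neg_pow (e : ℂ)]
        have : (-1 : ℂ) ^ r = (-1) ^ (r - j) * (-1) ^ j := by
          rw [← pow_add, Nat.sub_add_cancel hjr]
        rw [this]
        ring
      have hsign : (-1 : ℂ) ^ (r + 1 - n : ℤ) = -((-1) ^ r * (-1) ^ n) := by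
        rw [zpow_sub₀ (by norm_num), div_eq_mul_inv, zpow_natCast,
          inv_eq_of_mul_eq_one_left hsq, zpow_add₀ (by norm_num), zpow_natCast, zpow_one]
        ring
      have hk1 : ((e + 2 : ℕ) : ℂ) - 1 = e + 1 := by push_cast; ring
      rw [h0, hsign, hk1, div_eq_mul_inv, inv_eq_of_mul_eq_one_left hsq]
      simp_rw [Nat.sub_right_comm n _ 1]
      ring
    · refine lt_of_le_of_lt (totalDegree_finsetSum_le fun j hj => ?_) hre
      have hjr : j ≤ r := Nat.lt_succ_iff.1 (Finset.mem_range.1 hj)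
      refine (totalDegree_mul _ _).trans ?_
      rw [totalDegree_C, zero_add]
      exact (totalDegree_charpoly_coeff_le P hPdeg (by rw [Fintype.card_fin]; omega)).trans
        (Nat.mul_le_mul_right e hjr)
    · intro d hd
      rw [map_sum, esymm_eq_sum_esymm_cons (e : ℂ)]
      refine Finset.sum_congr rfl fun j hj => ?_
      have hjr : j ≤ r := Nat.lt_succ_iff.1 (Finset.mem_range.1 hj)
      rw [← hroots d hd, esymm_roots_charpoly _ (by rw [Fintype.card_fin]; omega), map_mul, eval_C,
        hPcoeff, Fintype.card_fin, mul_assoc]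
end
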